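/- (Proposition on the first part of the ergodic averages.) For each n ∈ {2, …, P} and each real p ≥ 1 there exist finite constants B_{1,n} and B_{2,p} such that, for every initialization x_{1:n}^{(0)} ∈ S_1 × ⋯ × S_n, every measurable f_n: E_n → ℝ with |f_n| ≤ 1 and every integer i ≥ 0, E[| π̂_n^{(i)}(f_n) − S_n^{(i)}(f_n) |^p]^{1/p} ≤ B_{1,n} B_{2,p}/(i+1)^{1/2}, where S_n^{(i)}(f_n) := (1/(i+1)) Σ_{m=0}^{i} ω_n(π̂_{n-1}^{(m)})(f_n). -/

import Mathlib

open MeasureTheory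
open scoped ENNReal

namespace Paper

noncomputable section

variable {E : Type*} [MeasurableSpace E]

/-- Metropolis–Hastings acceptance probability. -/
def acc {Z : Type*} (w : Z → ℝ≥0∞) (x x' : Z) : ℝ≥0∞ := min 1 (w x' / w x)

/-- The importance weight `w_{m+1}` on `E^{m+1}`. -/
def wgt (γ : (n : ℕ) → (Fin n → E) → ℝ≥0∞) (q : (m : ℕ) → (Fin m → E) → E → ℝ≥0∞)
    (m : ℕ) (x : Fin (m + 1) → E) : ℝ≥0∞ :=
  γ (m + 1) x / (γ m (Fin.init x) * q m (Fin.init x) (x (Fin.last m)))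

/-- The importance weight `w_1` on `E^1`. -/
def wgt1 (γ : (n : ℕ) → (Fin n → E) → ℝ≥0∞) (q1 : E → ℝ≥0∞) (x : Fin 1 → E) : ℝ≥0∞ :=
  γ 1 x / q1 (x 0)

/-- The proposal distribution `μ × q_{m+1}`, viewed as a measure on `E^{m+1}`. -/
def propM (dx : Measure E) (q : (m : ℕ) → (Fin m → E) → E → ℝ≥0∞) (m : ℕ)
    (μ : Measure (Fin m → E)) : Measure (Fin (m + 1) → E) :=
  Measure.map (fun p : (Fin m → E) × E => Fin.snoc p.1 p.2)
    ((μ.prod dx).withDensity fun p => q m p.1 p.2)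

/-- The proposal distribution at level 1, viewed as a measure on `E^1`. -/
def prop1 (dx : Measure E) (q1 : E → ℝ≥0∞) : Measure (Fin 1 → E) :=
  Measure.map (fun y : E => fun _ : Fin 1 => y) (dx.withDensity q1)

/-- The Metropolis–Hastings kernel `K_{m+1, μ}`. -/
def kerM (dx : Measure E) (γ : (n : ℕ) → (Fin n → E) → ℝ≥0∞)
    (q : (m : ℕ) → (Fin m → E) → E → ℝ≥0∞) (m : ℕ) (μ : Measure (Fin m → E))
    (x : Fin (m + 1) → E) : Measure (Fin (m + 1) → E) :=
  (propM dx q m μ).withDensity (acc (wgt γ q m) x) +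
    (1 - ∫⁻ y, acc (wgt γ q m) x y ∂(propM dx q m μ)) • Measure.dirac x

/-- The Metropolis–Hastings kernel `K_1`. -/
def ker1 (dx : Measure E) (γ : (n : ℕ) → (Fin n → E) → ℝ≥0∞) (q1 : E → ℝ≥0∞)
    (x : Fin 1 → E) : Measure (Fin 1 → E) :=
  (prop1 dx q1).withDensity (acc (wgt1 γ q1) x) +
    (1 - ∫⁻ y, acc (wgt1 γ q1) x y ∂(prop1 dx q1)) • Measure.dirac x

/-- The target distribution `π_n` on `E^n`. -/
def tgt (dx : Measure E) [SigmaFinite dx] (γ : (n : ℕ) → (Fin n → E) → ℝ≥0∞)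
    (Z : ℕ → ℝ≥0∞) (n : ℕ) : Measure (Fin n → E) :=
  (Measure.pi fun _ : Fin n => dx).withDensity fun x => γ n x / Z n

/-- The marginal density `π_{m+1}(x_m)`. -/
def marg (dx : Measure E) (γ : (n : ℕ) → (Fin n → E) → ℝ≥0∞) (Z : ℕ → ℝ≥0∞) (m : ℕ)
    (x : Fin m → E) : ℝ≥0∞ :=
  (∫⁻ y, γ (m + 1) (Fin.snoc x y) ∂dx) / Z (m + 1)

/-- The ratio `π_{(m+1)/m}(x_m) = π_{m+1}(x_m)/π_m(x_m)`. -/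
def ratio (dx : Measure E) (γ : (n : ℕ) → (Fin n → E) → ℝ≥0∞) (Z : ℕ → ℝ≥0∞) (m : ℕ)
    (x : Fin m → E) : ℝ≥0∞ :=
  marg dx γ Z m x / (γ m x / Z m)

/-- The invariant distribution `ω_{m+1}(μ)`. -/
def omegaM (dx : Measure E) (γ : (n : ℕ) → (Fin n → E) → ℝ≥0∞) (Z : ℕ → ℝ≥0∞) (m : ℕ)
    (μ : Measure (Fin m → E)) : Measure (Fin (m + 1) → E) :=
  (∫⁻ x, ratio dx γ Z m x ∂μ)⁻¹ •
    Measure.map (fun p : (Fin m → E) × E => Fin.snoc p.1 p.2)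
      ((μ.prod dx).withDensity fun p =>
        ratio dx γ Z m p.1 *
          ((γ (m + 1) (Fin.snoc p.1 p.2) / Z (m + 1)) / marg dx γ Z m p.1))

/-- The empirical measure `π̂_n^{(i)}(ω)`. -/
def emp {Ω : Type*} (X : (n : ℕ) → ℕ → Ω → (Fin n → E)) (n i : ℕ) (ω : Ω) :
    Measure (Fin n → E) :=
  ((i : ℝ≥0∞) + 1)⁻¹ • ∑ k ∈ Finset.range (i + 1), Measure.dirac (X n k ω)

/-- The σ-algebra generated by the variables generated strictly before `X_n^{(i)}`
in the order `X_1^{(1)}, …, X_P^{(1)}, X_1^{(2)}, …` (the variables `X_k^{(0)}`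
being given at initialization). -/
def past {Ω : Type*} (P : ℕ) (X : (n : ℕ) → ℕ → Ω → (Fin n → E)) (n i : ℕ) :
    MeasurableSpace Ω :=
  ⨆ (k : ℕ) (j : ℕ) (_ : (1 ≤ k ∧ k ≤ P ∧ j < i) ∨ (1 ≤ k ∧ k < n ∧ j = i)),
    MeasurableSpace.comap (X k j) inferInstance

/-! ### Metropolis–Hastings kernels with an independent proposal -/

section Abstract

variable {S : Type*} [MeasurableSpace S]

/-- The Metropolis–Hastings kernel with proposal `ρ` and acceptance probability `a`. -/
def mhKer (a : S → S → ℝ≥0∞) (ρ : Measure S) (x : S) : Measure S :=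
  ρ.withDensity (a x) + (1 - ∫⁻ y, a x y ∂ρ) • Measure.dirac x

/-- `a` is an acceptance probability that is reversible with respect to the bounded weight `W`
and dominates it. -/
structure IsAcceptance (a : S → S → ℝ≥0∞) (W : S → ℝ) : Prop where
  measurable_acc : Measurable fun p : S × S => a p.1 p.2
  acc_le_one : ∀ x y, a x y ≤ 1
  measurable_weight : Measurable W
  weight_nonneg : ∀ x, 0 ≤ W x
  weight_le : ∀ x y, W y ≤ (a x y).toReal
  symm : ∀ x y, W x * (a x y).toReal = W y * (a y x).toReal

/-- The part of the Metropolis–Hastings kernel left after removing the minorizing measure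
`W • ρ`. -/
def residual (a : S → S → ℝ≥0∞) (W : S → ℝ) (ρ : Measure S) (g : S → ℝ) (x : S) : ℝ :=
  ∫ y, ((a x y).toReal - W y) * g y ∂ρ + (1 - ∫ y, (a x y).toReal ∂ρ) * g x

/-- The truncated potential `∑_{k < N} Q^k f`, with `Q` the residual operator. -/
def potential (a : S → S → ℝ≥0∞) (W : S → ℝ) (f : S → ℝ) (ρ : Measure S) : ℕ → S → ℝ
  | 0 => 0
  | N + 1 => fun x => f x + residual a W ρ (potential a W f ρ N) x

lemma integrable_of_bdd {Ω : Type*} [MeasurableSpace Ω] {ρ : Measure Ω} [IsFiniteMeasure ρ]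
    {g : Ω → ℝ} (hg : Measurable g) {c : ℝ} (hc : ∀ x, |g x| ≤ c) : Integrable g ρ :=
  Integrable.of_bound hg.aestronglyMeasurable c (ae_of_all _ hc)

lemma abs_mul_le_of_le_one {u v c : ℝ} (hu : |u| ≤ 1) (hv : |v| ≤ c) : |u * v| ≤ c := by
  rw [abs_mul]
  nlinarith [abs_nonneg u, abs_nonneg v]

namespace IsAcceptance

variable {a : S → S → ℝ≥0∞} {W : S → ℝ} {ρ : Measure S} {f g : S → ℝ} {c : ℝ}

lemma measurable_right (h : IsAcceptance a W) (x : S) : Measurable (a x) :=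
  h.measurable_acc.comp measurable_prodMk_left

lemma toReal_le_one (h : IsAcceptance a W) (x y : S) : (a x y).toReal ≤ 1 :=
  ENNReal.toReal_le_of_le_ofReal zero_le_one (by simpa using h.acc_le_one x y)

lemma weight_le_one (h : IsAcceptance a W) (x : S) : W x ≤ 1 :=
  (h.weight_le x x).trans (h.toReal_le_one x x)

lemma abs_weight_le_one (h : IsAcceptance a W) (x : S) : |W x| ≤ 1 := by
  rw [abs_of_nonneg (h.weight_nonneg x)]
  exact h.weight_le_one x

lemma abs_toReal_le_one (h : IsAcceptance a W) (x y : S) : |(a x y).toReal| ≤ 1 := by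
  rw [abs_of_nonneg ENNReal.toReal_nonneg]
  exact h.toReal_le_one x y

lemma abs_diff_le_one (h : IsAcceptance a W) (x y : S) : |(a x y).toReal - W y| ≤ 1 := by
  rw [abs_of_nonneg (sub_nonneg.2 (h.weight_le x y))]
  linarith [h.toReal_le_one x y, h.weight_nonneg y]

lemma integral_weight_nonneg (h : IsAcceptance a W) : 0 ≤ ∫ y, W y ∂ρ :=
  integral_nonneg h.weight_nonneg

variable [IsProbabilityMeasure ρ]

lemma integrable_acc (h : IsAcceptance a W) (x : S) :
    Integrable (fun y => (a x y).toReal) ρ :=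
  integrable_of_bdd (h.measurable_right x).ennreal_toReal (h.abs_toReal_le_one x)

lemma integrable_weight (h : IsAcceptance a W) : Integrable W ρ :=
  integrable_of_bdd h.measurable_weight h.abs_weight_le_one

lemma integrable_weight_mul (h : IsAcceptance a W) (hg : Measurable g) (hc : ∀ x, |g x| ≤ c) :
    Integrable (fun y => W y * g y) ρ :=
  integrable_of_bdd (h.measurable_weight.mul hg)
    fun y => abs_mul_le_of_le_one (h.abs_weight_le_one y) (hc y)

lemma integrable_acc_mul (h : IsAcceptance a W) (x : S) (hg : Measurable g)
    (hc : ∀ x, |g x| ≤ c) : Integrable (fun y => (a x y).toReal * g y) ρ :=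
  integrable_of_bdd ((h.measurable_right x).ennreal_toReal.mul hg)
    fun y => abs_mul_le_of_le_one (h.abs_toReal_le_one x y) (hc y)

lemma integrable_diff_mul (h : IsAcceptance a W) (x : S) (hg : Measurable g)
    (hc : ∀ x, |g x| ≤ c) : Integrable (fun y => ((a x y).toReal - W y) * g y) ρ :=
  integrable_of_bdd (((h.measurable_right x).ennreal_toReal.sub h.measurable_weight).mul hg)
    fun y => abs_mul_le_of_le_one (h.abs_diff_le_one x y) (hc y)

lemma integral_acc_le_one (h : IsAcceptance a W) (x : S) :
    ∫ y, (a x y).toReal ∂ρ ≤ 1 := by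
  have := integral_mono (h.integrable_acc (ρ := ρ) x) (integrable_const 1) (h.toReal_le_one x)
  simpa using this

lemma lintegral_acc_le_one (h : IsAcceptance a W) (x : S) : ∫⁻ y, a x y ∂ρ ≤ 1 := by
  have := lintegral_mono (μ := ρ) (h.acc_le_one x)
  simpa using this

lemma isProbabilityMeasure_mhKer (h : IsAcceptance a W) (x : S) :
    IsProbabilityMeasure (mhKer a ρ x) := by
  constructor
  simp [mhKer, add_tsub_cancel_of_le (h.lintegral_acc_le_one x)]

lemma integral_mhKer (h : IsAcceptance a W) (x : S) (hg : Measurable g)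
    (hc : ∀ x, |g x| ≤ c) :
    ∫ y, g y ∂(mhKer a ρ x) = residual a W ρ g x + ∫ y, W y * g y ∂ρ := by
  have hp := h.isProbabilityMeasure_mhKer (ρ := ρ) x
  have hi : Integrable g (mhKer a ρ x) := integrable_of_bdd hg hc
  have hi' := integrable_add_measure.1 hi
  have hlt : ∀ᵐ y ∂ρ, a x y < ∞ :=
    ae_of_all _ fun y => (h.acc_le_one x y).trans_lt ENNReal.one_lt_top
  have h_int : ∫⁻ y, a x y ∂ρ = ENNReal.ofReal (∫ y, (a x y).toReal ∂ρ) := by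
    rw [integral_toReal (h.measurable_right x).aemeasurable hlt, ENNReal.ofReal_toReal]
    exact ((h.lintegral_acc_le_one x).trans_lt ENNReal.one_lt_top).ne
  have h1 : (1 - ∫⁻ y, a x y ∂ρ).toReal = 1 - ∫ y, (a x y).toReal ∂ρ := by
    rw [h_int, ENNReal.toReal_sub_of_le _ ENNReal.one_ne_top, ENNReal.toReal_one,
      ENNReal.toReal_ofReal (integral_nonneg fun _ => ENNReal.toReal_nonneg)]
    rw [← h_int]
    exact h.lintegral_acc_le_one x
  rw [mhKer, integral_add_measure hi'.1 hi'.2, integral_smul_measure,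
    integral_dirac' _ _ hg.stronglyMeasurable, h1,
    integral_withDensity_eq_integral_toReal_smul (h.measurable_right x) hlt, residual]
  simp only [smul_eq_mul, sub_mul]
  rw [integral_sub (h.integrable_acc_mul x hg hc) (h.integrable_weight_mul hg hc)]
  ring

lemma abs_residual_le (h : IsAcceptance a W) (x : S) (hg : Measurable g)
    (hc : ∀ x, |g x| ≤ c) : |residual a W ρ g x| ≤ (1 - ∫ y, W y ∂ρ) * c := by
  have h1 : |∫ y, ((a x y).toReal - W y) * g y ∂ρ| ≤
      (∫ y, (a x y).toReal ∂ρ - ∫ y, W y ∂ρ) * c := by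
    rw [← integral_sub (h.integrable_acc x) h.integrable_weight, ← integral_mul_const]
    refine (abs_integral_le_integral_abs).trans
      (integral_mono (h.integrable_diff_mul x hg hc).abs
        (((h.integrable_acc x).sub h.integrable_weight).mul_const c) fun y => ?_)
    simp only [abs_mul, abs_of_nonneg (sub_nonneg.2 (h.weight_le x y))]
    exact mul_le_mul_of_nonneg_left (hc y) (sub_nonneg.2 (h.weight_le x y))
  have h2 : |(1 - ∫ y, (a x y).toReal ∂ρ) * g x| ≤ (1 - ∫ y, (a x y).toReal ∂ρ) * c := by
    have := sub_nonneg.2 (h.integral_acc_le_one (ρ := ρ) x)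
    rw [abs_mul, abs_of_nonneg this]
    exact mul_le_mul_of_nonneg_left (hc x) this
  calc |residual a W ρ g x| ≤ _ := abs_add_le _ _
    _ ≤ _ := add_le_add h1 h2
    _ = _ := by ring

lemma measurable_residual (h : IsAcceptance a W) {T : Type*} [MeasurableSpace T]
    {r : T → Measure S} (hr : Measurable r) [∀ t, IsProbabilityMeasure (r t)]
    {G : T → S → ℝ} (hG : Measurable fun p : T × S => G p.1 p.2) :
    Measurable fun p : T × S => residual a W (r p.1) (G p.1) p.2 := by
  let κ : ProbabilityTheory.Kernel (T × S) S := ⟨fun p => r p.1, hr.comp measurable_fst⟩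
  have : ProbabilityTheory.IsMarkovKernel κ := ⟨fun p => by
    change IsProbabilityMeasure (r p.1); infer_instance⟩
  have ha : Measurable fun p : (T × S) × S => (a p.1.2 p.2).toReal :=
    (h.measurable_acc.comp (by fun_prop : Measurable fun p : (T × S) × S => (p.1.2, p.2))).ennreal_toReal
  have hG' : Measurable fun p : (T × S) × S => G p.1.1 p.2 :=
    hG.comp (by fun_prop : Measurable fun p : (T × S) × S => (p.1.1, p.2))
  have h1 := (StronglyMeasurable.integral_kernel_prod_right' (κ := κ)
    ((ha.sub (h.measurable_weight.comp measurable_snd)).mul hG').stronglyMeasurable).measurable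
  have h2 := (StronglyMeasurable.integral_kernel_prod_right' (κ := κ)
    ha.stronglyMeasurable).measurable
  exact h1.add ((measurable_const.sub h2).mul hG)

lemma measurable_potential_param (h : IsAcceptance a W) {T : Type*} [MeasurableSpace T]
    {r : T → Measure S} (hr : Measurable r) [∀ t, IsProbabilityMeasure (r t)]
    (hf : Measurable f) (N : ℕ) :
    Measurable fun p : T × S => potential a W f (r p.1) N p.2 := by
  induction N with
  | zero => exact measurable_const
  | succ N ih => exact (hf.comp measurable_snd).add (h.measurable_residual hr (G := fun t => potential a W f (r t) N) ih)

lemma measurable_potential (h : IsAcceptance a W) (hf : Measurable f) (N : ℕ) :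
    Measurable (potential a W f ρ N) :=
  (h.measurable_potential_param (T := Unit) (r := fun _ => ρ) measurable_const hf N).comp
    (measurable_prodMk_left (x := ()))

lemma integral_weight_le_one (h : IsAcceptance a W) : ∫ y, W y ∂ρ ≤ 1 := by
  have := integral_mono (h.integrable_weight (ρ := ρ)) (integrable_const 1) h.weight_le_one
  simpa using this

lemma abs_potential_le_nat (h : IsAcceptance a W) (hf : Measurable f) (hf1 : ∀ x, |f x| ≤ 1)
    (N : ℕ) (x : S) : |potential a W f ρ N x| ≤ N := by
  induction N generalizing x with
  | zero => simp [potential]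
  | succ N ih =>
    have h1 := h.abs_residual_le (ρ := ρ) x (h.measurable_potential hf N) ih
    have h2 : (1 - ∫ y, W y ∂ρ) * (N : ℝ) ≤ N := by
      nlinarith [h.integral_weight_nonneg (ρ := ρ), (N.cast_nonneg : (0 : ℝ) ≤ N)]
    have h3 := abs_add_le (f x) (residual a W ρ (potential a W f ρ N) x)
    have h4 := hf1 x
    simp only [potential]
    push_cast
    linarith

variable {ε : ℝ}

lemma abs_potential_le (h : IsAcceptance a W) (hf : Measurable f) (hf1 : ∀ x, |f x| ≤ 1)
    (hε : 0 < ε) (hW : ε ≤ ∫ y, W y ∂ρ) (N : ℕ) (x : S) :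
    |potential a W f ρ N x| ≤ 1 / ε := by
  induction N generalizing x with
  | zero => simp [potential, hε.le]
  | succ N ih =>
    have h1 := h.abs_residual_le (ρ := ρ) x (h.measurable_potential hf N) ih
    have h2 : (1 - ∫ y, W y ∂ρ) * (1 / ε) ≤ (1 - ε) * (1 / ε) := by gcongr
    have h3 := abs_add_le (f x) (residual a W ρ (potential a W f ρ N) x)
    have h4 := hf1 x
    have h5 : (1 - ε) * (1 / ε) = 1 / ε - 1 := by field_simp
    simp only [potential]
    linarith

lemma residual_sub (h : IsAcceptance a W) (x : S) {g' : S → ℝ} {c' : ℝ} (hg : Measurable g)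
    (hc : ∀ x, |g x| ≤ c) (hg' : Measurable g') (hc' : ∀ x, |g' x| ≤ c') :
    residual a W ρ g x - residual a W ρ g' x = residual a W ρ (fun y => g y - g' y) x := by
  simp only [residual, mul_sub]
  rw [integral_sub (h.integrable_diff_mul x hg hc) (h.integrable_diff_mul x hg' hc')]
  ring

lemma abs_potential_succ_sub_le (h : IsAcceptance a W) (hf : Measurable f)
    (hf1 : ∀ x, |f x| ≤ 1) (hW : ε ≤ ∫ y, W y ∂ρ) (N : ℕ) (x : S) :
    |potential a W f ρ (N + 1) x - potential a W f ρ N x| ≤ (1 - ε) ^ N := by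
  induction N generalizing x with
  | zero => simpa [potential, residual] using hf1 x
  | succ N ih =>
    have hm := fun N => h.measurable_potential (ρ := ρ) hf N
    have hb := fun N => h.abs_potential_le_nat (ρ := ρ) hf hf1 N
    have h1 := h.residual_sub (ρ := ρ) x (hm (N + 1)) (hb (N + 1)) (hm N) (hb N)
    have h2 := h.abs_residual_le (ρ := ρ) x ((hm (N + 1)).sub (hm N)) ih
    have h0 : 0 ≤ (1 - ε) ^ N := (abs_nonneg _).trans (ih x)
    have h3 : potential a W f ρ (N + 1 + 1) x - potential a W f ρ (N + 1) x =
        residual a W ρ (potential a W f ρ (N + 1)) x - residual a W ρ (potential a W f ρ N) x := by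
      rw [potential, potential]; ring
    rw [h3, h1]
    refine h2.trans ?_
    rw [pow_succ']
    gcongr

/-- Invariance of `W • ρ` under the Metropolis–Hastings kernel, in terms of the residual. -/
lemma integral_weight_mul_residual (h : IsAcceptance a W) (hg : Measurable g)
    (hc : ∀ x, |g x| ≤ c) :
    ∫ x, W x * residual a W ρ g x ∂ρ = (1 - ∫ y, W y ∂ρ) * ∫ y, W y * g y ∂ρ := by
  have haR : Measurable fun p : S × S => (a p.1 p.2).toReal := h.measurable_acc.ennreal_toReal
  have hJ : Measurable fun p : S × S => W p.1 * ((a p.1 p.2).toReal * g p.2) :=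
    (h.measurable_weight.comp measurable_fst).mul (haR.mul (hg.comp measurable_snd))
  have hJi : Integrable (fun p : S × S => W p.1 * ((a p.1 p.2).toReal * g p.2)) (ρ.prod ρ) :=
    integrable_of_bdd hJ fun p => abs_mul_le_of_le_one (h.abs_weight_le_one _)
      (abs_mul_le_of_le_one (h.abs_toReal_le_one _ _) (hc _))
  have hswap : ∫ x, ∫ y, W x * ((a x y).toReal * g y) ∂ρ ∂ρ =
      ∫ y, W y * g y * ∫ x, (a y x).toReal ∂ρ ∂ρ := by
    rw [integral_integral_swap hJi]
    refine integral_congr_ae (ae_of_all _ fun y => ?_)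
    simp only
    rw [← integral_const_mul]
    refine integral_congr_ae (ae_of_all _ fun x => ?_)
    simp only
    linear_combination g y * h.symm x y
  have hres : ∀ x, W x * residual a W ρ g x = (∫ y, W x * ((a x y).toReal * g y) ∂ρ) -
      W x * (∫ y, W y * g y ∂ρ) + W x * g x - W x * g x * ∫ y, (a x y).toReal ∂ρ := by
    intro x
    simp only [residual, sub_mul]
    rw [integral_sub (h.integrable_acc_mul x hg hc) (h.integrable_weight_mul hg hc),
      integral_const_mul]
    ring
  have i1 : Integrable (fun x => ∫ y, W x * ((a x y).toReal * g y) ∂ρ) ρ := hJi.integral_prod_left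
  have i2 : Integrable (fun x => W x * (∫ y, W y * g y ∂ρ)) ρ := h.integrable_weight.mul_const _
  have i3 : Integrable (fun x => W x * g x) ρ := h.integrable_weight_mul hg hc
  have i4 : Integrable (fun x => W x * g x * ∫ y, (a x y).toReal ∂ρ) ρ := by
    refine i3.mul_bdd (c := 1) ?_ (ae_of_all _ fun x => ?_)
    · exact (haR.stronglyMeasurable.integral_prod_right (ν := ρ)).aestronglyMeasurable
    · rw [Real.norm_eq_abs, abs_of_nonneg (integral_nonneg fun _ => ENNReal.toReal_nonneg)]
      exact h.integral_acc_le_one x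
  simp only [hres]
  have i12 : Integrable (fun x => ∫ y, W x * ((a x y).toReal * g y) ∂ρ -
      W x * (∫ y, W y * g y ∂ρ)) ρ := i1.sub i2
  have i123 : Integrable (fun x => ∫ y, W x * ((a x y).toReal * g y) ∂ρ -
      W x * (∫ y, W y * g y ∂ρ) + W x * g x) ρ := i12.add i3
  rw [integral_sub i123 i4, integral_add i12 i3, integral_sub i1 i2, hswap, integral_mul_const]
  ring

lemma integral_weight_mul_potential (h : IsAcceptance a W) (hf : Measurable f)
    (hf1 : ∀ x, |f x| ≤ 1) (hpos : 0 < ∫ y, W y ∂ρ) (N : ℕ) :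
    ∫ x, W x * potential a W f ρ N x ∂ρ =
      (1 - (1 - ∫ y, W y ∂ρ) ^ N) * ((∫ y, W y * f y ∂ρ) / ∫ y, W y ∂ρ) := by
  induction N with
  | zero => simp [potential]
  | succ N ih =>
    have hm := h.measurable_potential (ρ := ρ) hf N
    have hb := h.abs_potential_le_nat (ρ := ρ) hf hf1 N
    have hmr : Measurable (residual a W ρ (potential a W f ρ N)) :=
      (h.measurable_residual (T := Unit) (r := fun _ => ρ) measurable_const
        (G := fun _ => potential a W f ρ N) (hm.comp measurable_snd)).comp
        (measurable_prodMk_left (x := ()))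
    simp only [potential, mul_add]
    rw [integral_add (h.integrable_weight_mul hf hf1)
      (h.integrable_weight_mul hmr fun x => h.abs_residual_le x hm hb),
      h.integral_weight_mul_residual hm hb, ih]
    field_simp
    ring

lemma abs_weighted_mean_le (h : IsAcceptance a W) (hf : Measurable f)
    (hf1 : ∀ x, |f x| ≤ 1) : |(∫ y, W y * f y ∂ρ) / ∫ y, W y ∂ρ| ≤ 1 := by
  rw [abs_div, abs_of_nonneg (h.integral_weight_nonneg (ρ := ρ))]
  refine div_le_one_of_le₀ ?_ h.integral_weight_nonneg
  refine abs_integral_le_integral_abs.trans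
    (integral_mono (h.integrable_weight_mul hf hf1).abs h.integrable_weight fun y => ?_)
  simp only [abs_mul, abs_of_nonneg (h.weight_nonneg y)]
  exact mul_le_of_le_one_right (h.weight_nonneg y) (hf1 y)

/-- The potential solves the Poisson equation up to a geometrically small error. -/
lemma abs_poisson_error_le (h : IsAcceptance a W) (hf : Measurable f) (hf1 : ∀ x, |f x| ≤ 1)
    (hε : 0 < ε) (hW : ε ≤ ∫ y, W y ∂ρ) (N : ℕ) (x : S) :
    |(potential a W f ρ N x - ∫ y, potential a W f ρ N y ∂(mhKer a ρ x)) -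
      (f x - (∫ y, W y * f y ∂ρ) / ∫ y, W y ∂ρ)| ≤ 2 * (1 - ε) ^ N := by
  have hm := h.measurable_potential (ρ := ρ) hf N
  have hb := h.abs_potential_le_nat (ρ := ρ) hf hf1 N
  have h1 := h.abs_potential_succ_sub_le (ρ := ρ) hf hf1 hW N x
  have h2 : |(1 - ∫ y, W y ∂ρ) ^ N * ((∫ y, W y * f y ∂ρ) / ∫ y, W y ∂ρ)| ≤ (1 - ε) ^ N := by
    have h0 := sub_nonneg.2 (h.integral_weight_le_one (ρ := ρ))
    rw [abs_mul, abs_of_nonneg (pow_nonneg h0 N)]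
    refine (mul_le_of_le_one_right (pow_nonneg h0 N) (h.abs_weighted_mean_le hf hf1)).trans ?_
    gcongr
  rw [h.integral_mhKer x hm hb, h.integral_weight_mul_potential hf hf1 (hε.trans_le hW)]
  have h3 : potential a W f ρ (N + 1) x = f x + residual a W ρ (potential a W f ρ N) x := rfl
  have := abs_sub ((1 - ∫ y, W y ∂ρ) ^ N * ((∫ y, W y * f y ∂ρ) / ∫ y, W y ∂ρ))
    (potential a W f ρ (N + 1) x - potential a W f ρ N x)
  refine le_trans (le_of_eq ?_) (this.trans (by linarith))
  rw [h3]
  congr 1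
  ring

lemma abs_potential_sub_le (h : IsAcceptance a W) (hf : Measurable f) (hf1 : ∀ x, |f x| ≤ 1)
    (hε : 0 < ε) (hW : ε ≤ ∫ y, W y ∂ρ) {ρ' : Measure S} [IsProbabilityMeasure ρ']
    (hW' : ε ≤ ∫ y, W y ∂ρ') {η : ℝ} (hη : 0 ≤ η)
    (hd : ∀ g : S → ℝ, Measurable g → (∀ x, |g x| ≤ 1) → |∫ y, g y ∂ρ - ∫ y, g y ∂ρ'| ≤ η)
    (N : ℕ) (x : S) :
    |potential a W f ρ N x - potential a W f ρ' N x| ≤ 2 * η / ε ^ 2 := by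
  induction N generalizing x with
  | zero => simpa [potential] using by positivity
  | succ N ih =>
    have hm := h.measurable_potential (ρ := ρ) hf N
    have hm' := h.measurable_potential (ρ := ρ') hf N
    have hb := h.abs_potential_le_nat (ρ := ρ) hf hf1 N
    have hb' := h.abs_potential_le_nat (ρ := ρ') hf hf1 N
    have hbε := h.abs_potential_le (ρ := ρ) hf hf1 hε hW N
    set u := potential a W f ρ N with hu
    set u' := potential a W f ρ' N with hu'
    have e1 : |residual a W ρ u x - residual a W ρ' u x| ≤ 2 * η / ε := by
      have d1 := hd (fun y => ((a x y).toReal - W y) * (ε * u y))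
        (((h.measurable_right x).ennreal_toReal.sub h.measurable_weight).mul (hm.const_mul ε))
        (fun y => abs_mul_le_of_le_one (h.abs_diff_le_one x y) (by
          rw [abs_mul, abs_of_pos hε]
          calc ε * |u y| ≤ ε * (1 / ε) := by gcongr; exact hbε y
            _ = 1 := by field_simp))
      have d2 := hd (fun y => (a x y).toReal) (h.measurable_right x).ennreal_toReal
        (h.abs_toReal_le_one x)
      have hr : ∀ r : Measure S, ∫ y, ((a x y).toReal - W y) * (ε * u y) ∂r =
          ε * ∫ y, ((a x y).toReal - W y) * u y ∂r := fun r => by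
        rw [← integral_const_mul]
        congr 1
        ext y
        ring
      rw [hr, hr, ← mul_sub, abs_mul, abs_of_pos hε] at d1
      have d1' : |∫ y, ((a x y).toReal - W y) * u y ∂ρ - ∫ y, ((a x y).toReal - W y) * u y ∂ρ'| ≤
          η / ε := by
        rw [le_div_iff₀ hε]; linarith
      have d2' : |(∫ y, (a x y).toReal ∂ρ - ∫ y, (a x y).toReal ∂ρ') * u x| ≤ η / ε := by
        rw [abs_mul, div_eq_mul_one_div]
        exact mul_le_mul d2 (hbε x) (abs_nonneg _) hη
      have := abs_sub (∫ y, ((a x y).toReal - W y) * u y ∂ρ -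
        ∫ y, ((a x y).toReal - W y) * u y ∂ρ')
        ((∫ y, (a x y).toReal ∂ρ - ∫ y, (a x y).toReal ∂ρ') * u x)
      calc |residual a W ρ u x - residual a W ρ' u x| = _ := by
            simp only [residual]; congr 1; ring
        _ ≤ _ := this
        _ ≤ η / ε + η / ε := add_le_add d1' d2'
        _ = 2 * η / ε := by ring
    have e2 : |residual a W ρ' u x - residual a W ρ' u' x| ≤ (1 - ε) * (2 * η / ε ^ 2) := by
      rw [h.residual_sub x hm hb hm' hb']
      refine (h.abs_residual_le x (hm.sub hm') ih).trans ?_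
      gcongr
    calc |potential a W f ρ (N + 1) x - potential a W f ρ' (N + 1) x|
        = |(residual a W ρ u x - residual a W ρ' u x) +
            (residual a W ρ' u x - residual a W ρ' u' x)| := by
          simp only [potential, ← hu, ← hu']; congr 1; ring
      _ ≤ _ := abs_add_le _ _
      _ ≤ 2 * η / ε + (1 - ε) * (2 * η / ε ^ 2) := add_le_add e1 e2
      _ = 2 * η / ε ^ 2 := by field_simp; ring

end IsAcceptance

/-! ### Exponential moments of bounded martingales -/

lemma exp_mul_le_cosh_add {u c : ℝ} (hc : 0 < c) (hu : |u| ≤ c) (t : ℝ) :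
    Real.exp (t * u) ≤ Real.cosh (t * c) + u / c * Real.sinh (t * c) := by
  obtain ⟨h1, h2⟩ := abs_le.1 hu
  have hl : 0 ≤ (c + u) / (2 * c) := by apply div_nonneg <;> linarith
  have hr : 0 ≤ (c - u) / (2 * c) := by apply div_nonneg <;> linarith
  have hconv := convexOn_exp.2 (Set.mem_univ (t * c)) (Set.mem_univ (-(t * c))) hl hr
    (by field_simp; ring)
  simp only [smul_eq_mul] at hconv
  have e1 : (c + u) / (2 * c) * (t * c) + (c - u) / (2 * c) * -(t * c) = t * u := by
    field_simp; ring
  rw [e1] at hconv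
  refine hconv.trans (le_of_eq ?_)
  rw [Real.cosh_eq, Real.sinh_eq]
  field_simp
  ring

lemma integral_exp_sum_le {Ω : Type*} [MeasurableSpace Ω] {μ : Measure Ω}
    [IsProbabilityMeasure μ] {U : ℕ → Ω → ℝ} {c C : ℝ} (hc : 0 < c)
    (hU : ∀ k, Measurable (U k)) (hC : ∀ k ω, |U k ω| ≤ C) (hb : ∀ k, ∀ᵐ ω ∂μ, |U k ω| ≤ c)
    (t : ℝ)
    (horth : ∀ k, ∫ ω, Real.exp (t * ∑ j ∈ Finset.range k, U j ω) * U k ω ∂μ = 0) (n : ℕ) :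
    Integrable (fun ω => Real.exp (t * ∑ j ∈ Finset.range n, U j ω)) μ ∧
      ∫ ω, Real.exp (t * ∑ j ∈ Finset.range n, U j ω) ∂μ ≤ Real.cosh (t * c) ^ n := by
  have hmeas : ∀ n, Measurable fun ω => Real.exp (t * ∑ j ∈ Finset.range n, U j ω) := fun n =>
    Real.measurable_exp.comp ((Finset.measurable_sum _ fun j _ => hU j).const_mul t)
  have h_int : ∀ n, Integrable (fun ω => Real.exp (t * ∑ j ∈ Finset.range n, U j ω)) μ := fun n =>
    integrable_of_bdd (hmeas n) (c := Real.exp (|t| * (n * C))) fun ω => by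
      rw [abs_of_pos (Real.exp_pos _), Real.exp_le_exp]
      refine (le_abs_self _).trans ?_
      rw [abs_mul]
      refine mul_le_mul_of_nonneg_left ?_ (abs_nonneg t)
      refine (Finset.abs_sum_le_sum_abs _ _).trans ?_
      simpa using Finset.sum_le_card_nsmul (Finset.range n) _ C fun j _ => hC j ω
  refine ⟨h_int n, ?_⟩
  induction n with
  | zero => simp
  | succ n ih =>
    have hint_exp : Integrable
        (fun ω => Real.exp (t * ∑ j ∈ Finset.range n, U j ω) * U n ω) μ :=
      (h_int n).mul_bdd (c := C) (hU n).aestronglyMeasurable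
        (ae_of_all _ fun ω => by rw [Real.norm_eq_abs]; exact hC n ω)
    have hle : ∫ ω, Real.exp (t * ∑ j ∈ Finset.range (n + 1), U j ω) ∂μ ≤
        ∫ ω, (Real.cosh (t * c) * Real.exp (t * ∑ j ∈ Finset.range n, U j ω) +
          Real.sinh (t * c) / c *
            (Real.exp (t * ∑ j ∈ Finset.range n, U j ω) * U n ω)) ∂μ := by
      refine integral_mono_ae (h_int (n + 1))
        (((h_int n).const_mul _).add (hint_exp.const_mul _)) ?_
      filter_upwards [hb n] with ω hω
      have h1 := exp_mul_le_cosh_add hc hω t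
      rw [Finset.sum_range_succ, mul_add, Real.exp_add]
      refine (mul_le_mul_of_nonneg_left h1 (Real.exp_pos _).le).trans (le_of_eq ?_)
      ring
    rw [integral_add ((h_int n).const_mul _) (hint_exp.const_mul _), integral_const_mul,
      integral_const_mul, horth n, mul_zero, add_zero] at hle
    refine hle.trans ?_
    rw [pow_succ']
    exact mul_le_mul_of_nonneg_left ih (Real.cosh_pos _).le

/-! ### Conditional laws -/

section CondLaw

open ProbabilityTheory

lemma map_prodMk_eq_compProd {Ω Ω' S : Type*} [MeasurableSpace Ω] [MeasurableSpace Ω']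
    [MeasurableSpace S] {μ : Measure Ω} [IsProbabilityMeasure μ] {Y : Ω → Ω'} (hY : Measurable Y)
    {X : Ω → S} (hX : Measurable X) (κ : Kernel Ω' S) [IsMarkovKernel κ]
    (h : ∀ A B, MeasurableSet A → MeasurableSet B →
      μ (Y ⁻¹' A ∩ X ⁻¹' B) = ∫⁻ ω in Y ⁻¹' A, κ (Y ω) B ∂μ) :
    μ.map (fun ω => (Y ω, X ω)) = (μ.map Y) ⊗ₘ κ := by
  have := Measure.isProbabilityMeasure_map (μ := μ) hY.aemeasurable
  have := Measure.isProbabilityMeasure_map (μ := μ) (hY.prodMk hX).aemeasurable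
  refine Measure.ext_prod fun {A B} hA hB => ?_
  rw [Measure.map_apply (hY.prodMk hX) (hA.prod hB), Measure.compProd_apply_prod hA hB,
    setLIntegral_map hA (κ.measurable_coe hB) hY, ← h A B hA hB]
  rfl

lemma integral_prodMk_eq {Ω S : Type*} {m mΩ : MeasurableSpace Ω} [MeasurableSpace S]
    (hm : m ≤ mΩ) {μ : Measure Ω} [IsProbabilityMeasure μ] {X : Ω → S} (hX : Measurable X)
    {κ : Ω → Measure S} (hκ : Measurable[m] κ) [hκp : ∀ ω, IsProbabilityMeasure (κ ω)]
    (hlaw : ∀ g : S → ℝ, Measurable g → (∀ z, |g z| ≤ 1) →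
      (μ[(fun ω => g (X ω))|m]) =ᵐ[μ] fun ω => ∫ z, g z ∂(κ ω))
    {G : Ω × S → ℝ} (hG : Measurable[m.prod inferInstance] G) {C : ℝ} (hC : ∀ p, |G p| ≤ C) :
    ∫ ω, G (ω, X ω) ∂μ = ∫ ω, ∫ z, G (ω, z) ∂(κ ω) ∂μ := by
  let κ' : @Kernel Ω S m _ := @Kernel.mk Ω S m _ κ hκ
  have hκ' : @IsMarkovKernel Ω S m _ κ' := @IsMarkovKernel.mk Ω S m _ κ' hκp
  have hid : @Measurable Ω Ω mΩ m id := measurable_id'' hm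
  have key := @map_prodMk_eq_compProd Ω Ω S mΩ m _ μ _ id hid X hX κ' hκ' (by
    intro A B hA hB
    have hBm : Measurable (B.indicator (fun _ => (1 : ℝ))) := measurable_const.indicator hB
    have hB1 : ∀ z, |B.indicator (fun _ => (1 : ℝ)) z| ≤ 1 := fun z => by
      by_cases hz : z ∈ B <;> simp [hz]
    have h1 := hlaw _ hBm hB1
    have h2 : ∫ ω in A, (μ[(fun ω => B.indicator (fun _ => (1 : ℝ)) (X ω))|m]) ω ∂μ =
        ∫ ω in A, B.indicator (fun _ => (1 : ℝ)) (X ω) ∂μ :=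
      setIntegral_condExp hm (integrable_of_bdd (hBm.comp hX) fun ω => hB1 _) hA
    have hA' : MeasurableSet A := hm A hA
    rw [setIntegral_congr_ae (g := fun ω => (κ ω).real B) hA' (by
      filter_upwards [h1] with ω hω _
      rw [hω, integral_indicator_const _ hB]
      simp)] at h2
    have h3 : ∫ ω in A, B.indicator (fun _ => (1 : ℝ)) (X ω) ∂μ = (μ (A ∩ X ⁻¹' B)).toReal := by
      have : (fun ω => B.indicator (fun _ => (1 : ℝ)) (X ω)) =
          (X ⁻¹' B).indicator (fun _ => (1 : ℝ)) := rfl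
      rw [this, integral_indicator_const _ (hX hB), Measure.real,
        Measure.restrict_apply (hX hB), Set.inter_comm]
      simp
    rw [h3] at h2
    have hmeas : Measurable fun ω => κ ω B :=
      (Measure.measurable_coe hB).comp (hκ.mono hm le_rfl)
    have h4 : ∫ ω in A, (κ ω).real B ∂μ = (∫⁻ ω in A, κ ω B ∂μ).toReal :=
      integral_toReal hmeas.aemeasurable (ae_of_all _ fun ω => measure_lt_top _ _)
    rw [h4] at h2
    refine ((ENNReal.toReal_eq_toReal_iff' ?_ (measure_ne_top _ _)).1 h2).symm
    refine ((lintegral_mono fun ω => prob_le_one (μ := κ ω) (s := B)).trans_lt ?_).ne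
    simp)
  have hprob : @IsProbabilityMeasure Ω m (@Measure.map Ω Ω mΩ m id μ) :=
    @Measure.isProbabilityMeasure_map Ω Ω mΩ m μ _ id
      (@Measurable.aemeasurable Ω Ω mΩ m id μ hid)
  have hpair : @Measurable Ω (Ω × S) mΩ (m.prod inferInstance) (fun ω => (id ω, X ω)) :=
    hid.prodMk hX
  have hpair' := @Measurable.aemeasurable Ω (Ω × S) mΩ (m.prod inferInstance) _ μ hpair
  have e1 := @integral_map Ω ℝ _ _ mΩ μ (Ω × S) (m.prod inferInstance) _ hpair' G
    hG.stronglyMeasurable.aestronglyMeasurable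
  have e2 := @Measure.integral_compProd Ω S m _ κ' (@Measure.map Ω Ω mΩ m id μ) _ _ ℝ _ _ G
    (by
      rw [← key]
      have := @Measure.isProbabilityMeasure_map Ω (Ω × S) mΩ (m.prod inferInstance) μ _ _
        hpair'
      exact @integrable_of_bdd (Ω × S) (m.prod inferInstance) _ _ G hG C hC)
  rw [← key, e1] at e2
  refine e2.trans ?_
  have hGi : @StronglyMeasurable Ω ℝ _ m fun ω => ∫ z, G (ω, z) ∂(κ' ω) :=
    @StronglyMeasurable.integral_kernel_prod_right' Ω S m _ κ' ℝ _ _ _ G hG.stronglyMeasurable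
  exact @integral_map Ω ℝ _ _ mΩ μ Ω m id
    (@Measurable.aemeasurable Ω Ω mΩ m id μ hid) _ hGi.aestronglyMeasurable

end CondLaw

/-! ### Moment bounds -/

lemma rpow_le_factorial_mul_exp {s p : ℝ} (hs : 0 ≤ s) (hp : 1 ≤ p) :
    s ^ p ≤ (1 + (⌈p⌉₊.factorial : ℝ)) * Real.exp s := by
  have hexp : 1 ≤ Real.exp s := Real.one_le_exp hs
  have hfac : (0 : ℝ) < ⌈p⌉₊.factorial := by exact_mod_cast Nat.factorial_pos _
  rcases le_total s 1 with h1 | h1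
  · have : s ^ p ≤ 1 := Real.rpow_le_one hs h1 (by linarith)
    nlinarith
  · have h2 : s ^ p ≤ s ^ (⌈p⌉₊ : ℝ) := Real.rpow_le_rpow_of_exponent_le h1 (Nat.le_ceil p)
    rw [Real.rpow_natCast] at h2
    have h3 := Real.pow_div_factorial_le_exp s hs ⌈p⌉₊
    rw [div_le_iff₀ hfac] at h3
    nlinarith

lemma moment_le_of_exp_moment {Ω : Type*} [MeasurableSpace Ω] {μ : Measure Ω}
    {Z M : Ω → ℝ} {c L D p : ℝ} (hc : 0 < c) (hL : 0 < L) (hD : 0 ≤ D) (hp : 1 ≤ p)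
    (hZ : ∀ᵐ ω ∂μ, |Z ω| ≤ |M ω| + c * L * D)
    (hi : Integrable (fun ω => Real.exp ((c * L)⁻¹ * M ω)) μ)
    (hi' : Integrable (fun ω => Real.exp (-(c * L)⁻¹ * M ω)) μ)
    (hM : ∫ ω, Real.exp ((c * L)⁻¹ * M ω) ∂μ ≤ Real.exp 1)
    (hM' : ∫ ω, Real.exp (-(c * L)⁻¹ * M ω) ∂μ ≤ Real.exp 1) :
    (∫ ω, |(L ^ 2)⁻¹ * Z ω| ^ p ∂μ) ^ (1 / p) ≤
      c * (2 * Real.exp (D + 1)) * (1 + (⌈p⌉₊.factorial : ℝ)) ^ (1 / p) / L := by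
  have hp0 : 0 < p := by linarith
  have hcL : 0 < c * L := mul_pos hc hL
  set Cp : ℝ := 1 + (⌈p⌉₊.factorial : ℝ) with hCp
  have hCp0 : 0 < Cp := by positivity
  have hpt : ∀ᵐ ω ∂μ, |(L ^ 2)⁻¹ * Z ω| ^ p ≤ (c / L) ^ p * (Cp * Real.exp D) *
      (Real.exp ((c * L)⁻¹ * M ω) + Real.exp (-(c * L)⁻¹ * M ω)) := by
    filter_upwards [hZ] with ω hω
    have hs : |(L ^ 2)⁻¹ * Z ω| = c / L * (|Z ω| / (c * L)) := by
      rw [abs_mul, abs_of_pos (by positivity : 0 < (L ^ 2)⁻¹)]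
      field_simp
    have hs0 : 0 ≤ |Z ω| / (c * L) := by positivity
    have hsle : |Z ω| / (c * L) ≤ D + |(c * L)⁻¹ * M ω| := by
      rw [abs_mul, abs_of_pos (inv_pos.2 hcL), div_le_iff₀ hcL]
      refine hω.trans (le_of_eq ?_)
      field_simp
      ring
    rw [hs, Real.mul_rpow (by positivity) hs0, mul_assoc]
    refine mul_le_mul_of_nonneg_left ?_ (by positivity)
    refine (rpow_le_factorial_mul_exp hs0 hp).trans ?_
    rw [mul_assoc]
    refine mul_le_mul_of_nonneg_left ?_ hCp0.le
    refine (Real.exp_le_exp.2 hsle).trans ?_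
    rw [Real.exp_add]
    refine mul_le_mul_of_nonneg_left ?_ (Real.exp_pos _).le
    rw [neg_mul]
    exact Real.exp_abs_le _
  have hle := integral_mono_of_nonneg (ae_of_all _ fun ω => by positivity)
    ((hi.add hi').const_mul ((c / L) ^ p * (Cp * Real.exp D))) hpt
  simp only [Pi.add_apply] at hle
  rw [integral_const_mul, integral_add hi hi'] at hle
  have hle2 : ∫ ω, |(L ^ 2)⁻¹ * Z ω| ^ p ∂μ ≤ (c / L) ^ p * Cp * (2 * Real.exp (D + 1)) := by
    refine hle.trans ?_
    calc _ ≤ (c / L) ^ p * (Cp * Real.exp D) * (Real.exp 1 + Real.exp 1) :=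
          mul_le_mul_of_nonneg_left (add_le_add hM hM') (by positivity)
      _ = _ := by rw [Real.exp_add]; ring
  have hcl : 0 ≤ c / L := by positivity
  have hone : 1 ≤ 2 * Real.exp (D + 1) := by
    have := Real.one_le_exp (by linarith : 0 ≤ D + 1)
    linarith
  calc (∫ ω, |(L ^ 2)⁻¹ * Z ω| ^ p ∂μ) ^ (1 / p)
      ≤ ((c / L) ^ p * Cp * (2 * Real.exp (D + 1))) ^ (1 / p) :=
        Real.rpow_le_rpow (integral_nonneg fun ω => by positivity) hle2 (by positivity)
    _ = c / L * Cp ^ (1 / p) * (2 * Real.exp (D + 1)) ^ (1 / p) := by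
        rw [Real.mul_rpow (by positivity) (by positivity),
          Real.mul_rpow (by positivity) hCp0.le, ← Real.rpow_mul hcl,
          mul_one_div_cancel hp0.ne', Real.rpow_one]
    _ ≤ c / L * Cp ^ (1 / p) * (2 * Real.exp (D + 1)) := by
        refine mul_le_mul_of_nonneg_left ?_ (by positivity)
        calc (2 * Real.exp (D + 1)) ^ (1 / p) ≤ (2 * Real.exp (D + 1)) ^ (1 : ℝ) :=
              Real.rpow_le_rpow_of_exponent_le hone (by rw [div_le_one hp0]; exact hp)
          _ = _ := Real.rpow_one _
    _ = _ := by ring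

lemma sum_inv_add_two_le (n : ℕ) :
    ∑ k ∈ Finset.range n, 2 / ((k : ℝ) + 2) ≤ 4 * √((n : ℝ) + 1) := by
  induction n with
  | zero => simp
  | succ n ih =>
    rw [Finset.sum_range_succ]
    push_cast
    have h0 : (0 : ℝ) ≤ n := n.cast_nonneg
    have e1 : √((n : ℝ) + 1) ^ 2 = n + 1 := Real.sq_sqrt (by linarith)
    have e2 : √((n : ℝ) + 1 + 1) ^ 2 = n + 2 := by rw [Real.sq_sqrt (by linarith)]; ring
    have h1 : √((n : ℝ) + 1) ≤ √((n : ℝ) + 1 + 1) := Real.sqrt_le_sqrt (by linarith)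
    have h2 : (1 : ℝ) ≤ √((n : ℝ) + 1 + 1) := Real.one_le_sqrt.2 (by linarith)
    have h3 := Real.sqrt_nonneg ((n : ℝ) + 1)
    have h4 : 2 / ((n : ℝ) + 2) ≤ 4 * (√((n : ℝ) + 1 + 1) - √((n : ℝ) + 1)) := by
      rw [div_le_iff₀ (by linarith), ← e2]
      set u := √((n : ℝ) + 1)
      set v := √((n : ℝ) + 1 + 1)
      have h5 : (v - u) * (v + u) = 1 := by nlinarith
      have h6 : 1 ≤ (v - u) * (2 * v) := by nlinarith
      nlinarith
    linarith

section ErgodicAverages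

open ProbabilityTheory

namespace IsAcceptance

variable {S : Type*} [MeasurableSpace S] {a : S → S → ℝ≥0∞} {W : S → ℝ} {f : S → ℝ} {ε : ℝ}

lemma measurable_mhKer (h : IsAcceptance a W) {T : Type*} [MeasurableSpace T]
    {r : T → Measure S} (hr : Measurable r) [∀ t, IsProbabilityMeasure (r t)]
    {x : T → S} (hx : Measurable x) : Measurable fun t => mhKer a (r t) (x t) := by
  let κ : Kernel T S := ⟨r, hr⟩
  have : IsMarkovKernel κ := ⟨fun t => by change IsProbabilityMeasure (r t); infer_instance⟩
  have ha : Measurable fun p : T × S => a (x p.1) p.2 :=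
    h.measurable_acc.comp ((hx.comp measurable_fst).prodMk measurable_snd)
  refine Measure.measurable_of_measurable_coe _ fun B hB => ?_
  have e : ∀ t, mhKer a (r t) (x t) B = ∫⁻ y, B.indicator (fun y => a (x t) y) y ∂(κ t) +
      (1 - ∫⁻ y, a (x t) y ∂(κ t)) * B.indicator 1 (x t) := fun t => by
    simp only [mhKer, Measure.add_apply, Measure.smul_apply, smul_eq_mul,
      withDensity_apply _ hB, lintegral_indicator hB, Measure.dirac_apply' _ hB]
    rfl
  simp only [e]
  have hind : Measurable fun p : T × S => B.indicator (fun y => a (x p.1) y) p.2 := by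
    have : (fun p : T × S => B.indicator (fun y => a (x p.1) y) p.2) =
        (Prod.snd ⁻¹' B).indicator fun p : T × S => a (x p.1) p.2 := by
      ext p
      by_cases hp : p.2 ∈ B <;> simp [hp]
    rw [this]
    exact ha.indicator (measurable_snd hB)
  refine (hind.lintegral_kernel_prod_right' (κ := κ)).add ((measurable_const.sub
    (ha.lintegral_kernel_prod_right' (κ := κ))).mul ?_)
  exact (measurable_one.indicator hB).comp hx

lemma measurable_integral_mhKer (h : IsAcceptance a W) {T : Type*} [MeasurableSpace T]
    {r : T → Measure S} (hr : Measurable r) [∀ t, IsProbabilityMeasure (r t)]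
    {x : T → S} (hx : Measurable x) {G : T × S → ℝ} (hG : Measurable G) :
    Measurable fun t => ∫ y, G (t, y) ∂(mhKer a (r t) (x t)) := by
  let κ : Kernel T S := ⟨_, h.measurable_mhKer hr hx⟩
  have : IsMarkovKernel κ := ⟨fun t => h.isProbabilityMeasure_mhKer _⟩
  exact (StronglyMeasurable.integral_kernel_prod_right' (κ := κ) hG.stronglyMeasurable).measurable

/-- The martingale decomposition of the centred sums. -/
lemma abs_centered_sum_le (h : IsAcceptance a W) (hf : Measurable f) (hf1 : ∀ x, |f x| ≤ 1)
    (hε : 0 < ε) {ρ : ℕ → Measure S} [∀ i, IsProbabilityMeasure (ρ i)]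
    (hW : ∀ i, ε ≤ ∫ y, W y ∂(ρ i))
    (hstab : ∀ i, ∀ g : S → ℝ, Measurable g → (∀ x, |g x| ≤ 1) →
      |∫ y, g y ∂(ρ (i + 1)) - ∫ y, g y ∂(ρ i)| ≤ 2 / ((i : ℝ) + 2))
    (x : ℕ → S) (N n : ℕ) (hN : n * (1 - ε) ^ N ≤ 1) :
    |∑ k ∈ Finset.range (n + 1), f (x k) -
      ∑ k ∈ Finset.range (n + 1), (∫ y, W y * f y ∂(ρ k)) / ∫ y, W y ∂(ρ k)| ≤
    |∑ k ∈ Finset.range n, (potential a W f (ρ (k + 1)) N (x (k + 1)) -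
      ∫ y, potential a W f (ρ (k + 1)) N y ∂(mhKer a (ρ (k + 1)) (x k)))| +
      (4 + 2 / ε + 8 / ε ^ 2) * √((n : ℝ) + 1) := by
  set u : ℕ → S → ℝ := fun k => potential a W f (ρ k) N with hu
  set v : ℕ → ℝ := fun k => ∫ y, u (k + 1) y ∂(mhKer a (ρ (k + 1)) (x k)) with hv
  set w : ℕ → ℝ := fun k => (∫ y, W y * f y ∂(ρ k)) / ∫ y, W y ∂(ρ k) with hw
  set e : ℕ → ℝ := fun k => (u (k + 1) (x k) - v k) - (f (x k) - w (k + 1)) with he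
  have hdecomp : ∑ k ∈ Finset.range (n + 1), f (x k) - ∑ k ∈ Finset.range (n + 1), w k =
      ∑ k ∈ Finset.range n, (u (k + 1) (x (k + 1)) - v k) + (f (x n) - w 0) +
        (u 0 (x 0) - u n (x n)) + ∑ k ∈ Finset.range n, (u (k + 1) (x k) - u k (x k)) -
        ∑ k ∈ Finset.range n, e k := by
    rw [Finset.sum_range_succ, Finset.sum_range_succ' w]
    have htel := Finset.sum_range_sub (fun k => u k (x k)) n
    simp only [he, Finset.sum_sub_distrib] at htel ⊢
    linarith
  have hub : ∀ k y, |u k y| ≤ 1 / ε := fun k y => h.abs_potential_le hf hf1 hε (hW k) N y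
  have b1 : |f (x n) - w 0| ≤ 2 := by
    have := abs_sub (f (x n)) (w 0)
    have h1 := hf1 (x n)
    have h2 := h.abs_weighted_mean_le (ρ := ρ 0) hf hf1
    simp only [hw] at this ⊢
    linarith
  have b2 : |u 0 (x 0) - u n (x n)| ≤ 2 / ε := by
    have := abs_sub (u 0 (x 0)) (u n (x n))
    have h1 := hub 0 (x 0)
    have h2 := hub n (x n)
    have h3 : 2 / ε = 1 / ε + 1 / ε := by ring
    linarith
  have b3 : |∑ k ∈ Finset.range n, (u (k + 1) (x k) - u k (x k))| ≤
      8 / ε ^ 2 * √((n : ℝ) + 1) := by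
    refine (Finset.abs_sum_le_sum_abs _ _).trans ?_
    have : ∀ k ∈ Finset.range n, |u (k + 1) (x k) - u k (x k)| ≤
        2 / ε ^ 2 * (2 / ((k : ℝ) + 2)) := fun k _ => by
      refine (h.abs_potential_sub_le hf hf1 hε (hW (k + 1)) (hW k) (by positivity) (hstab k) N
        (x k)).trans (le_of_eq ?_)
      ring
    refine (Finset.sum_le_sum this).trans ?_
    rw [← Finset.mul_sum]
    refine (mul_le_mul_of_nonneg_left (sum_inv_add_two_le n) (by positivity)).trans (le_of_eq ?_)
    ring
  have b4 : |∑ k ∈ Finset.range n, e k| ≤ 2 := by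
    refine (Finset.abs_sum_le_sum_abs _ _).trans ?_
    refine (Finset.sum_le_card_nsmul (Finset.range n) _ (2 * (1 - ε) ^ N) fun k _ =>
      h.abs_poisson_error_le hf hf1 hε (hW (k + 1)) N (x k)).trans ?_
    simp only [Finset.card_range, nsmul_eq_mul]
    linarith
  have hL : 1 ≤ √((n : ℝ) + 1) := Real.one_le_sqrt.2 (by linarith [n.cast_nonneg (α := ℝ)])
  have hLb : 4 + 2 / ε + 8 / ε ^ 2 * √((n : ℝ) + 1) ≤
      (4 + 2 / ε + 8 / ε ^ 2) * √((n : ℝ) + 1) := by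
    have : 0 ≤ 4 + 2 / ε := by positivity
    nlinarith
  rw [hdecomp]
  refine (abs_sub _ _).trans ?_
  have t1 := abs_add_le (∑ k ∈ Finset.range n, (u (k + 1) (x (k + 1)) - v k) + (f (x n) - w 0) +
    (u 0 (x 0) - u n (x n))) (∑ k ∈ Finset.range n, (u (k + 1) (x k) - u k (x k)))
  have t2 := abs_add_le (∑ k ∈ Finset.range n, (u (k + 1) (x (k + 1)) - v k) + (f (x n) - w 0))
    (u 0 (x 0) - u n (x n))
  have t3 := abs_add_le (∑ k ∈ Finset.range n, (u (k + 1) (x (k + 1)) - v k)) (f (x n) - w 0)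
  linarith

/-- `L^p` bound for the centred ergodic averages of an adaptive Metropolis–Hastings process. -/
theorem moment_ergodic_average_le (h : IsAcceptance a W) (hf : Measurable f)
    (hf1 : ∀ x, |f x| ≤ 1) (hε : 0 < ε) {Ω : Type*} {mΩ : MeasurableSpace Ω} {μ : Measure Ω}
    [IsProbabilityMeasure μ] {F : ℕ → MeasurableSpace Ω} (hF : ∀ i, F i ≤ mΩ)
    (hmono : Monotone F) {X : ℕ → Ω → S} (hX : ∀ i, Measurable[F (i + 1)] (X i))
    {ρ : ℕ → Ω → Measure S} (hρ : ∀ i, Measurable[F i] (ρ i))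
    [hρp : ∀ i ω, IsProbabilityMeasure (ρ i ω)]
    (hlaw : ∀ i, ∀ g : S → ℝ, Measurable g → (∀ z, |g z| ≤ 1) →
      (μ[(fun ω => g (X (i + 1) ω))|F (i + 1)]) =ᵐ[μ]
        fun ω => ∫ z, g z ∂(mhKer a (ρ (i + 1) ω) (X i ω)))
    (hW : ∀ᵐ ω ∂μ, ∀ i, ε ≤ ∫ y, W y ∂(ρ i ω))
    (hstab : ∀ i ω, ∀ g : S → ℝ, Measurable g → (∀ x, |g x| ≤ 1) →
      |∫ y, g y ∂(ρ (i + 1) ω) - ∫ y, g y ∂(ρ i ω)| ≤ 2 / ((i : ℝ) + 2))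
    {p : ℝ} (hp : 1 ≤ p) (n : ℕ) :
    (∫ ω, |((n : ℝ) + 1)⁻¹ * (∑ k ∈ Finset.range (n + 1), f (X k ω)) -
        ((n : ℝ) + 1)⁻¹ * (∑ k ∈ Finset.range (n + 1),
          (∫ y, W y * f y ∂(ρ k ω)) / ∫ y, W y ∂(ρ k ω))| ^ p ∂μ) ^ (1 / p) ≤
      2 / ε * (2 * Real.exp ((4 + 2 / ε + 8 / ε ^ 2) / (2 / ε) + 1)) *
        (1 + (⌈p⌉₊.factorial : ℝ)) ^ (1 / p) / ((n : ℝ) + 1) ^ ((1 : ℝ) / 2) := by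
  have hε1 : ε ≤ 1 := by
    obtain ⟨ω, hω⟩ := hW.exists
    exact (hω 0).trans h.integral_weight_le_one
  obtain ⟨N, hN⟩ : ∃ N : ℕ, n * (1 - ε) ^ N ≤ 1 := by
    obtain ⟨N, hN⟩ := exists_pow_lt_of_lt_one (by positivity : (0 : ℝ) < 1 / ((n : ℝ) + 1))
      (by linarith : 1 - ε < 1)
    refine ⟨N, ?_⟩
    rw [lt_div_iff₀ (by positivity)] at hN
    have : 0 ≤ (1 - ε) ^ N := pow_nonneg (by linarith) N
    linarith
  let U : ℕ → Ω → ℝ := fun k ω => potential a W f (ρ (k + 1) ω) N (X (k + 1) ω) -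
      ∫ y, potential a W f (ρ (k + 1) ω) N y ∂(mhKer a (ρ (k + 1) ω) (X k ω))
  have hpot : ∀ k, Measurable[(F k).prod inferInstance]
      fun q : Ω × S => potential a W f (ρ k q.1) N q.2 := fun k =>
    @measurable_potential_param S _ a W f h Ω (F k) (ρ k) (hρ k) (hρp k) hf N
  have hVm : ∀ k, Measurable[F (k + 1)] fun ω =>
      ∫ y, potential a W f (ρ (k + 1) ω) N y ∂(mhKer a (ρ (k + 1) ω) (X k ω)) := fun k =>
    @measurable_integral_mhKer S _ a W h Ω (F (k + 1)) (ρ (k + 1)) (hρ (k + 1)) (hρp (k + 1))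
      (X k) (hX k) (fun q => potential a W f (ρ (k + 1) q.1) N q.2) (hpot (k + 1))
  have hUm : ∀ k, Measurable[F (k + 2)] (U k) := fun k => by
    refine Measurable.sub ?_ ((hVm k).mono (hmono (by omega)) le_rfl)
    have hid : @Measurable Ω Ω (F (k + 2)) (F (k + 1)) id := measurable_id'' (hmono (by omega))
    exact (hpot (k + 1)).comp (hid.prodMk (hX (k + 1)))
  have hVb : ∀ k ω {C : ℝ}, (∀ y, |potential a W f (ρ (k + 1) ω) N y| ≤ C) →
      |∫ y, potential a W f (ρ (k + 1) ω) N y ∂(mhKer a (ρ (k + 1) ω) (X k ω))| ≤ C := by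
    intro k ω C hC
    have := h.isProbabilityMeasure_mhKer (ρ := ρ (k + 1) ω) (X k ω)
    have := norm_integral_le_of_norm_le_const (μ := mhKer a (ρ (k + 1) ω) (X k ω))
      (f := potential a W f (ρ (k + 1) ω) N) (C := C) (ae_of_all _ hC)
    simpa using this
  have hUb : ∀ k ω {C : ℝ}, (∀ y, |potential a W f (ρ (k + 1) ω) N y| ≤ C) →
      |U k ω| ≤ C + C := fun k ω C hC =>
    (abs_sub _ _).trans (add_le_add (hC _) (hVb k ω hC))
  have hUN : ∀ k ω, |U k ω| ≤ N + N := fun k ω =>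
    hUb k ω fun y => h.abs_potential_le_nat hf hf1 N y
  have hUε : ∀ k, ∀ᵐ ω ∂μ, |U k ω| ≤ 2 / ε := fun k => by
    filter_upwards [hW] with ω hω
    have := hUb k ω fun y => h.abs_potential_le hf hf1 hε (hω (k + 1)) N y
    exact this.trans (le_of_eq (by ring))
  have horth : ∀ t k, ∫ ω, Real.exp (t * ∑ j ∈ Finset.range k, U j ω) * U k ω ∂μ = 0 := by
    intro t k
    set D : Ω → ℝ := fun ω => Real.exp (t * ∑ j ∈ Finset.range k, U j ω) with hD
    have hDm : Measurable[F (k + 1)] D := by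
      refine Real.measurable_exp.comp (Measurable.const_mul ?_ t)
      refine Finset.measurable_sum _ fun j hj => ?_
      have : j < k := Finset.mem_range.1 hj
      exact (hUm j).mono (hmono (by omega)) le_rfl
    have hDb : ∀ ω, |D ω| ≤ Real.exp (|t| * (k * (N + N))) := fun ω => by
      rw [abs_of_pos (Real.exp_pos _), Real.exp_le_exp]
      refine (le_abs_self _).trans ?_
      rw [abs_mul]
      refine mul_le_mul_of_nonneg_left ?_ (abs_nonneg t)
      refine (Finset.abs_sum_le_sum_abs _ _).trans ?_
      simpa only [Finset.card_range, nsmul_eq_mul] using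
        Finset.sum_le_card_nsmul (Finset.range k) _ _ fun j _ => hUN j ω
    have hpN : ∀ ω y, |potential a W f (ρ (k + 1) ω) N y| ≤ N := fun ω y =>
      h.abs_potential_le_nat hf hf1 N y
    have hker : Measurable[F (k + 1)] fun ω => mhKer a (ρ (k + 1) ω) (X k ω) :=
      @measurable_mhKer S _ a W h Ω (F (k + 1)) (ρ (k + 1)) (hρ (k + 1)) (hρp (k + 1)) (X k) (hX k)
    have hDfst : Measurable[(F (k + 1)).prod inferInstance] fun q : Ω × S => D q.1 :=
      @Measurable.comp (Ω × S) Ω ℝ ((F (k + 1)).prod inferInstance) (F (k + 1)) _ D Prod.fst hDm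
        (@measurable_fst Ω S (F (k + 1)) _)
    have key := @integral_prodMk_eq Ω S (F (k + 1)) mΩ _ (hF _) μ _ (X (k + 1))
      ((hX (k + 1)).mono (hF _) le_rfl) (fun ω => mhKer a (ρ (k + 1) ω) (X k ω)) hker
      (fun ω => h.isProbabilityMeasure_mhKer _) (hlaw k)
      (fun q => D q.1 * potential a W f (ρ (k + 1) q.1) N q.2)
      (hDfst.mul (hpot (k + 1)))
      (Real.exp (|t| * (k * (N + N))) * N) (fun q => by
        rw [abs_mul]
        exact mul_le_mul (hDb _) (hpN _ _) (abs_nonneg _) (Real.exp_pos _).le)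
    simp only [integral_const_mul] at key
    have hD' : Measurable D := hDm.mono (hF _) le_rfl
    have hV' := (hVm k).mono (hF _) le_rfl
    have hU' : Measurable (U k) := (hUm k).mono (hF _) le_rfl
    have i2 : Integrable (fun ω => D ω *
        ∫ y, potential a W f (ρ (k + 1) ω) N y ∂(mhKer a (ρ (k + 1) ω) (X k ω))) μ :=
      integrable_of_bdd (hD'.mul hV') (c := Real.exp (|t| * (k * (N + N))) * N) fun ω => by
        rw [abs_mul]
        exact mul_le_mul (hDb _) (hVb k ω (hpN ω)) (abs_nonneg _) (Real.exp_pos _).le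
    have i3 : Integrable (fun ω => D ω * U k ω) μ :=
      integrable_of_bdd (hD'.mul hU') (c := Real.exp (|t| * (k * (N + N))) * (N + N)) fun ω => by
        rw [abs_mul]
        exact mul_le_mul (hDb _) (hUN k ω) (abs_nonneg _) (Real.exp_pos _).le
    have e : ∀ ω, D ω * potential a W f (ρ (k + 1) ω) N (X (k + 1) ω) = D ω * U k ω + D ω *
        ∫ y, potential a W f (ρ (k + 1) ω) N y ∂(mhKer a (ρ (k + 1) ω) (X k ω)) := fun ω => by
      simp only [U]; ring
    simp only [e] at key
    rw [integral_add i3 i2] at key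
    linarith
  have hc : 0 < 2 / ε := by positivity
  have hn : (0 : ℝ) < (n : ℝ) + 1 := by positivity
  have hL : 0 < √((n : ℝ) + 1) := Real.sqrt_pos.2 hn
  have hsq : √((n : ℝ) + 1) ^ 2 = n + 1 := Real.sq_sqrt hn.le
  have hexp := fun t => integral_exp_sum_le hc (fun k => (hUm k).mono (hF _) le_rfl) hUN hUε t
    (horth t) n
  have hcosh : ∀ s : ℝ, s ^ 2 = ((n : ℝ) + 1)⁻¹ → Real.cosh s ^ n ≤ Real.exp 1 := fun s hs => by
    have h1 := pow_le_pow_left₀ (Real.cosh_pos s).le (Real.cosh_le_exp_half_sq s) n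
    refine h1.trans ?_
    rw [← Real.exp_nat_mul, Real.exp_le_exp, hs]
    rw [inv_eq_one_div, div_div, mul_one_div, div_le_one (by positivity)]
    linarith
  have hbound : ∀ᵐ ω ∂μ, |∑ k ∈ Finset.range (n + 1), f (X k ω) -
      ∑ k ∈ Finset.range (n + 1), (∫ y, W y * f y ∂(ρ k ω)) / ∫ y, W y ∂(ρ k ω)| ≤
      |∑ k ∈ Finset.range n, U k ω| +
        2 / ε * √((n : ℝ) + 1) * ((4 + 2 / ε + 8 / ε ^ 2) / (2 / ε)) := by
    filter_upwards [hW] with ω hω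
    refine (h.abs_centered_sum_le hf hf1 hε hω (fun i => hstab i ω) (fun k => X k ω) N n
      hN).trans (le_of_eq ?_)
    congr 1
    field_simp
  have hsq1 : ((2 / ε * √((n : ℝ) + 1))⁻¹ * (2 / ε)) ^ 2 = ((n : ℝ) + 1)⁻¹ := by
    have : ((2 / ε * √((n : ℝ) + 1))⁻¹ * (2 / ε)) ^ 2 = (√((n : ℝ) + 1) ^ 2)⁻¹ := by field_simp
    rw [this, hsq]
  have := moment_le_of_exp_moment hc hL (by positivity) hp hbound
    (hexp _).1 (hexp _).1 ((hexp _).2.trans (hcosh _ hsq1))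
    ((hexp _).2.trans (hcosh _ (by rw [neg_mul, neg_sq, hsq1])))
  rw [hsq] at this
  rw [← Real.sqrt_eq_rpow]
  simpa only [mul_sub] using this

end IsAcceptance

end ErgodicAverages

end Abstract

/-! ### The interacting kernels -/

section Interacting

open ProbabilityTheory

variable {dx : Measure E} {γ : (n : ℕ) → (Fin n → E) → ℝ≥0∞} {Z : ℕ → ℝ≥0∞}
  {q : (m : ℕ) → (Fin m → E) → E → ℝ≥0∞} {m : ℕ}

lemma isAcceptance_acc {S : Type*} [MeasurableSpace S] {w : S → ℝ≥0∞} (hw : Measurable w)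
    {β : ℝ≥0∞} (hβ : β ≠ ⊤) (hwβ : ∀ x, w x ≤ β) :
    IsAcceptance (acc w) fun x => (w x).toReal / (β.toReal + 1) := by
  have hwt : ∀ x, w x ≠ ⊤ := fun x => ((hwβ x).trans_lt hβ.lt_top).ne
  have hb0 : 0 ≤ β.toReal := ENNReal.toReal_nonneg
  have hwr : ∀ x, (w x).toReal ≤ β.toReal := fun x => ENNReal.toReal_mono hβ (hwβ x)
  have hacc : ∀ x y, w x ≠ 0 → (acc w x y).toReal = min 1 ((w y).toReal / (w x).toReal) := by
    intro x y hx
    rw [acc, ENNReal.toReal_min ENNReal.one_ne_top (ENNReal.div_ne_top (hwt y) hx),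
      ENNReal.toReal_one, ENNReal.toReal_div]
  refine ⟨?_, fun x y => min_le_left _ _, hw.ennreal_toReal.div_const _, fun x => by positivity,
    fun x y => ?_, fun x y => ?_⟩
  · exact measurable_const.min ((hw.comp measurable_snd).div (hw.comp measurable_fst))
  · by_cases hx : w x = 0
    · by_cases hy : w y = 0
      · simp [hy]
      · have : acc w x y = 1 := by simp [acc, hx, ENNReal.div_zero hy]
        rw [this, ENNReal.toReal_one, div_le_one (by positivity)]
        linarith [hwr y]
    · have hxp : 0 < (w x).toReal := ENNReal.toReal_pos hx (hwt x)
      rw [hacc x y hx]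
      refine le_min ?_ ?_
      · rw [div_le_one (by positivity)]
        linarith [hwr y]
      · exact div_le_div_of_nonneg_left ENNReal.toReal_nonneg hxp (by linarith [hwr x])
  · have key : ∀ x y, (w x).toReal * (acc w x y).toReal = min (w x).toReal (w y).toReal := by
      intro x y
      by_cases hx : w x = 0
      · simp [hx]
      · have hxp : 0 < (w x).toReal := ENNReal.toReal_pos hx (hwt x)
        rw [hacc x y hx, mul_min_of_nonneg _ _ hxp.le, mul_one, mul_div_cancel₀ _ hxp.ne']
    rw [div_mul_eq_mul_div, div_mul_eq_mul_div, key, key, min_comm]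

lemma measurable_snoc :
    Measurable fun p : (Fin m → E) × E => (Fin.snoc p.1 p.2 : Fin (m + 1) → E) := by
  refine measurable_pi_iff.2 fun j => ?_
  refine Fin.lastCases ?_ (fun j => ?_) j
  · simpa using measurable_snd
  · simpa using (by fun_prop : Measurable fun p : (Fin m → E) × E => p.1 j)

lemma measurable_init : Measurable fun x : Fin (m + 1) → E => (Fin.init x : Fin m → E) :=
  measurable_pi_iff.2 fun _ => measurable_pi_apply _

lemma measurable_wgt (hγ : Measurable (γ m)) (hγ' : Measurable (γ (m + 1)))
    (hq : Measurable fun p : (Fin m → E) × E => q m p.1 p.2) : Measurable (wgt γ q m) :=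
  hγ'.div ((hγ.comp measurable_init).mul
    (hq.comp (measurable_init.prodMk (measurable_pi_apply _))))

lemma wgt_le {β ζ : ℝ≥0∞} (hζ : ζ ≠ ⊤)
    (hA : ∀ x : Fin (m + 1) → E, 0 < γ (m + 1) x / ζ → wgt γ q m x ≤ β)
    (x : Fin (m + 1) → E) : wgt γ q m x ≤ β := by
  by_cases hx : γ (m + 1) x = 0
  · simp [wgt, hx]
  · exact hA x (ENNReal.div_pos hx hζ)

lemma wgt_snoc (x : Fin m → E) (y : E) :
    wgt γ q m (Fin.snoc x y) = γ (m + 1) (Fin.snoc x y) / (γ m x * q m x y) := by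
  simp [wgt]

section Empirical

variable {Ω : Type*} {X : (n : ℕ) → ℕ → Ω → (Fin n → E)} {n : ℕ}

instance isProbabilityMeasure_emp (i : ℕ) (ω : Ω) : IsProbabilityMeasure (emp X n i ω) := by
  constructor
  simp only [emp, Measure.smul_apply, Measure.coe_finsetSum, Finset.sum_apply, measure_univ,
    Finset.sum_const, Finset.card_range, smul_eq_mul, nsmul_eq_mul, mul_one]
  push_cast
  exact ENNReal.inv_mul_cancel (by simp) (by finiteness)

lemma lintegral_emp {g : (Fin n → E) → ℝ≥0∞} (hg : Measurable g) (i : ℕ) (ω : Ω) :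
    ∫⁻ x, g x ∂(emp X n i ω) =
      ((i : ℝ≥0∞) + 1)⁻¹ * ∑ k ∈ Finset.range (i + 1), g (X n k ω) := by
  simp [emp, lintegral_smul_measure, lintegral_finsetSum_measure, lintegral_dirac' _ hg]

end Empirical

variable [SigmaFinite dx]

lemma lintegral_propM (hq : Measurable fun p : (Fin m → E) × E => q m p.1 p.2)
    (μ : Measure (Fin m → E)) [SFinite μ] {g : (Fin (m + 1) → E) → ℝ≥0∞} (hg : Measurable g) :
    ∫⁻ z, g z ∂(propM dx q m μ) = ∫⁻ x, ∫⁻ y, q m x y * g (Fin.snoc x y) ∂dx ∂μ := by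
  have hgs : Measurable fun p : (Fin m → E) × E => g (Fin.snoc p.1 p.2) :=
    hg.comp measurable_snoc
  rw [propM, lintegral_map hg measurable_snoc, lintegral_withDensity_eq_lintegral_mul _ hq hgs,
    lintegral_prod _ (hq.mul hgs).aemeasurable]
  rfl

lemma measurable_lintegral_snoc (hq : Measurable fun p : (Fin m → E) × E => q m p.1 p.2)
    {g : (Fin (m + 1) → E) → ℝ≥0∞} (hg : Measurable g) :
    Measurable fun x => ∫⁻ y, q m x y * g (Fin.snoc x y) ∂dx :=
  (hq.mul (hg.comp measurable_snoc)).lintegral_prod_right'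

lemma isProbabilityMeasure_propM (hq : Measurable fun p : (Fin m → E) × E => q m p.1 p.2)
    (hqd : ∀ x, ∫⁻ y, q m x y ∂dx = 1) (μ : Measure (Fin m → E)) [IsProbabilityMeasure μ] :
    IsProbabilityMeasure (propM dx q m μ) := by
  constructor
  have := lintegral_propM (dx := dx) hq μ (g := fun _ => 1) measurable_const
  simpa [hqd] using this

variable {Ω : Type*} {X : (n : ℕ) → ℕ → Ω → (Fin n → E)}

lemma propM_emp_eq_sum (hq : Measurable fun p : (Fin m → E) × E => q m p.1 p.2) (i : ℕ) (ω : Ω) :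
    propM dx q m (emp X m i ω) = ((i : ℝ≥0∞) + 1)⁻¹ • ∑ k ∈ Finset.range (i + 1),
      propM dx q m (Measure.dirac (X m k ω)) := by
  refine Measure.ext_of_lintegral _ fun g hg => ?_
  rw [lintegral_propM hq _ hg, lintegral_emp (measurable_lintegral_snoc hq hg),
    lintegral_smul_measure, lintegral_finsetSum_measure, smul_eq_mul]
  congr 1
  refine Finset.sum_congr rfl fun k _ => ?_
  rw [lintegral_propM hq _ hg, lintegral_dirac' _ (measurable_lintegral_snoc hq hg)]

lemma measurable_propM_emp [MeasurableSpace Ω]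
    (hq : Measurable fun p : (Fin m → E) × E => q m p.1 p.2) {i : ℕ}
    (hX : ∀ k ≤ i, Measurable (X m k)) : Measurable fun ω => propM dx q m (emp X m i ω) := by
  refine Measure.measurable_of_measurable_coe _ fun B hB => ?_
  have hB' : Measurable (B.indicator (1 : (Fin (m + 1) → E) → ℝ≥0∞)) := measurable_one.indicator hB
  have e : ∀ ω, propM dx q m (emp X m i ω) B = ((i : ℝ≥0∞) + 1)⁻¹ *
      ∑ k ∈ Finset.range (i + 1), ∫⁻ y, q m (X m k ω) y *
        B.indicator (1 : (Fin (m + 1) → E) → ℝ≥0∞) (Fin.snoc (X m k ω) y) ∂dx := fun ω => by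
    rw [← lintegral_indicator_one hB, lintegral_propM hq _ hB',
      lintegral_emp (measurable_lintegral_snoc hq hB')]
  simp only [e]
  refine Measurable.const_mul (Finset.measurable_sum _ fun k hk => ?_) _
  exact (measurable_lintegral_snoc hq hB').comp (hX k (Nat.lt_succ_iff.1 (Finset.mem_range.1 hk)))

lemma integral_propM_emp (hq : Measurable fun p : (Fin m → E) × E => q m p.1 p.2)
    (hqd : ∀ x, ∫⁻ y, q m x y ∂dx = 1) {g : (Fin (m + 1) → E) → ℝ} (hg : Measurable g)
    (hg1 : ∀ x, |g x| ≤ 1) (i : ℕ) (ω : Ω) :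
    ∫ z, g z ∂(propM dx q m (emp X m i ω)) = ((i : ℝ) + 1)⁻¹ *
      ∑ k ∈ Finset.range (i + 1), ∫ z, g z ∂(propM dx q m (Measure.dirac (X m k ω))) := by
  have hp := fun k => isProbabilityMeasure_propM (dx := dx) hq hqd (Measure.dirac (X m k ω))
  rw [propM_emp_eq_sum hq, integral_smul_measure, integral_finsetSum_measure fun k _ =>
    integrable_of_bdd hg hg1, smul_eq_mul, ENNReal.toReal_inv]
  congr 2

lemma abs_integral_propM_emp_sub_le (hq : Measurable fun p : (Fin m → E) × E => q m p.1 p.2)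
    (hqd : ∀ x, ∫⁻ y, q m x y ∂dx = 1) {g : (Fin (m + 1) → E) → ℝ} (hg : Measurable g)
    (hg1 : ∀ x, |g x| ≤ 1) (i : ℕ) (ω : Ω) :
    |∫ z, g z ∂(propM dx q m (emp X m (i + 1) ω)) - ∫ z, g z ∂(propM dx q m (emp X m i ω))| ≤
      2 / ((i : ℝ) + 2) := by
  rw [integral_propM_emp hq hqd hg hg1, integral_propM_emp hq hqd hg hg1, Finset.sum_range_succ]
  set b : ℕ → ℝ := fun k => ∫ z, g z ∂(propM dx q m (Measure.dirac (X m k ω))) with hb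
  have hb1 : ∀ k, |b k| ≤ 1 := fun k => by
    have := isProbabilityMeasure_propM (dx := dx) hq hqd (Measure.dirac (X m k ω))
    have := norm_integral_le_of_norm_le_const (μ := propM dx q m (Measure.dirac (X m k ω)))
      (f := g) (C := 1) (ae_of_all _ hg1)
    simpa using this
  have hs : |∑ k ∈ Finset.range (i + 1), b k| ≤ (i : ℝ) + 1 := by
    refine (Finset.abs_sum_le_sum_abs _ _).trans ?_
    simpa using Finset.sum_le_card_nsmul (Finset.range (i + 1)) _ 1 fun k _ => hb1 k
  have hi : (0 : ℝ) < (i : ℝ) + 1 := by positivity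
  have hi2 : (0 : ℝ) < (i : ℝ) + 2 := by positivity
  have e : (((i + 1 : ℕ) : ℝ) + 1)⁻¹ * (∑ k ∈ Finset.range (i + 1), b k + b (i + 1)) -
      ((i : ℝ) + 1)⁻¹ * ∑ k ∈ Finset.range (i + 1), b k =
      (b (i + 1) - ((i : ℝ) + 1)⁻¹ * ∑ k ∈ Finset.range (i + 1), b k) / ((i : ℝ) + 2) := by
    have : ((i + 1 : ℕ) : ℝ) + 1 = (i : ℝ) + 2 := by push_cast; ring
    rw [this]
    field_simp
    ring
  rw [e, abs_div, abs_of_pos hi2]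
  gcongr
  refine (abs_sub _ _).trans ?_
  have h2 : |((i : ℝ) + 1)⁻¹ * ∑ k ∈ Finset.range (i + 1), b k| ≤ 1 := by
    rw [abs_mul, abs_of_pos (inv_pos.2 hi), inv_mul_le_iff₀ hi]
    linarith
  linarith [hb1 (i + 1)]

lemma mul_wgt_snoc (hqpos : ∀ x y, 0 < q m x y) (hqfin : ∀ x y, q m x y ≠ ⊤) (x : Fin m → E)
    (y : E) :
    q m x y * wgt γ q m (Fin.snoc x y) = γ (m + 1) (Fin.snoc x y) * (γ m x)⁻¹ := by
  rw [wgt_snoc, div_eq_mul_inv,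
    ENNReal.mul_inv (Or.inr (hqfin x y)) (Or.inr (hqpos x y).ne')]
  calc _ = γ (m + 1) (Fin.snoc x y) * (γ m x)⁻¹ * (q m x y * (q m x y)⁻¹) := by ring
    _ = _ := by rw [ENNReal.mul_inv_cancel (hqpos x y).ne' (hqfin x y), mul_one]

lemma ratio_eq (hγ' : Measurable (γ (m + 1))) (hqpos : ∀ x y, 0 < q m x y)
    (hqfin : ∀ x y, q m x y ≠ ⊤) (hZ0 : Z m ≠ 0) (hZt : Z m ≠ ⊤) (x : Fin m → E) :
    ratio dx γ Z m x =
      Z m / Z (m + 1) * ∫⁻ y, q m x y * wgt γ q m (Fin.snoc x y) ∂dx := by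
  have hG : Measurable fun y => γ (m + 1) (Fin.snoc x y : Fin (m + 1) → E) :=
    hγ'.comp (measurable_snoc.comp measurable_prodMk_left)
  simp only [mul_wgt_snoc hqpos hqfin]
  rw [lintegral_mul_const _ hG, ratio, marg, div_eq_mul_inv _ (γ m x / Z m),
    ENNReal.inv_div (Or.inl hZt) (Or.inl hZ0)]
  simp only [div_eq_mul_inv]
  ring

lemma lintegral_mul_wgt_le (hqd : ∀ x, ∫⁻ y, q m x y ∂dx = 1)
    (hq : Measurable fun p : (Fin m → E) × E => q m p.1 p.2)
    {β : ℝ≥0∞} (hβ : ∀ x, wgt γ q m x ≤ β) (x : Fin m → E) :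
    ∫⁻ y, q m x y * wgt γ q m (Fin.snoc x y) ∂dx ≤ β := by
  calc _ ≤ ∫⁻ y, q m x y * β ∂dx := by
        gcongr
        exact hβ _
    _ = β := by
        rw [lintegral_mul_const _ (show Measurable (q m x) from hq.comp measurable_prodMk_left),
          hqd, one_mul]

lemma ratio_mul_div_marg (hq : Measurable fun p : (Fin m → E) × E => q m p.1 p.2)
    (hγ' : Measurable (γ (m + 1))) (hγt : ∀ x, γ m x ≠ ⊤)
    (hqpos : ∀ x y, 0 < q m x y)
    (hqfin : ∀ x y, q m x y ≠ ⊤) (hqd : ∀ x, ∫⁻ y, q m x y ∂dx = 1)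
    (hZ0 : Z m ≠ 0) (hZt : Z m ≠ ⊤) (hZ0' : Z (m + 1) ≠ 0)
    {β : ℝ≥0∞} (hβt : β ≠ ⊤) (hβ : ∀ x, wgt γ q m x ≤ β)
    {δ : ℝ≥0∞} (hδ0 : 0 < δ) (hδ : ∀ x, 0 < γ m x / Z m → δ ≤ ratio dx γ Z m x)
    (x : Fin m → E) (y : E) :
    ratio dx γ Z m x * ((γ (m + 1) (Fin.snoc x y) / Z (m + 1)) / marg dx γ Z m x) =
      Z m / Z (m + 1) * (q m x y * wgt γ q m (Fin.snoc x y)) := by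
  by_cases hx : γ m x = 0
  · have : γ (m + 1) (Fin.snoc x y) = 0 := by
      by_contra h0
      have := hβ (Fin.snoc x y)
      rw [wgt_snoc, hx, zero_mul, ENNReal.div_zero h0] at this
      exact hβt (top_le_iff.1 this)
    simp [wgt_snoc, this]
  · have hx0 : γ m x / Z m ≠ 0 := (ENNReal.div_pos hx hZt).ne'
    have hr : ratio dx γ Z m x ≠ 0 := (hδ0.trans_le (hδ x (pos_iff_ne_zero.2 hx0))).ne'
    have hrt : ratio dx γ Z m x ≠ ⊤ := by
      rw [ratio_eq hγ' hqpos hqfin hZ0 hZt]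
      exact ENNReal.mul_ne_top (ENNReal.div_ne_top hZt hZ0')
        ((lintegral_mul_wgt_le hqd hq hβ x).trans_lt hβt.lt_top).ne
    have hm0 : marg dx γ Z m x ≠ 0 := fun h => hr (by simp [ratio, h])
    have hmt : marg dx γ Z m x ≠ ⊤ := fun h => hrt (by
      rw [ratio, h, ENNReal.top_div_of_ne_top (ENNReal.div_ne_top (hγt x) hZ0)])
    rw [mul_wgt_snoc hqpos hqfin, ratio, div_eq_mul_inv _ (γ m x / Z m),
      ENNReal.inv_div (Or.inl hZt) (Or.inl hZ0)]
    simp only [div_eq_mul_inv]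
    calc _ = (marg dx γ Z m x * (marg dx γ Z m x)⁻¹) *
          (Z m * (Z (m + 1))⁻¹ * (γ (m + 1) (Fin.snoc x y) * (γ m x)⁻¹)) := by ring
      _ = _ := by rw [ENNReal.mul_inv_cancel hm0 hmt, one_mul]

lemma omegaM_eq (hq : Measurable fun p : (Fin m → E) × E => q m p.1 p.2)
    (hγ : Measurable (γ m)) (hγ' : Measurable (γ (m + 1))) (hγt : ∀ x, γ m x ≠ ⊤)
    (hqpos : ∀ x y, 0 < q m x y)
    (hqfin : ∀ x y, q m x y ≠ ⊤) (hqd : ∀ x, ∫⁻ y, q m x y ∂dx = 1)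
    (hZ0 : Z m ≠ 0) (hZt : Z m ≠ ⊤) (hZ0' : Z (m + 1) ≠ 0) (hZt' : Z (m + 1) ≠ ⊤)
    {β : ℝ≥0∞} (hβt : β ≠ ⊤) (hβ : ∀ x, wgt γ q m x ≤ β)
    {δ : ℝ≥0∞} (hδ0 : 0 < δ) (hδ : ∀ x, 0 < γ m x / Z m → δ ≤ ratio dx γ Z m x)
    (μ : Measure (Fin m → E)) [SFinite μ] :
    omegaM dx γ Z m μ = (∫⁻ z, wgt γ q m z ∂(propM dx q m μ))⁻¹ •
      (propM dx q m μ).withDensity (wgt γ q m) := by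
  have hw := measurable_wgt hγ hγ' hq
  have hC0 : Z m / Z (m + 1) ≠ 0 := (ENNReal.div_pos hZ0 hZt').ne'
  have hCt : Z m / Z (m + 1) ≠ ⊤ := ENNReal.div_ne_top hZt hZ0'
  refine Measure.ext_of_lintegral _ fun g hg => ?_
  have hgs : Measurable fun p : (Fin m → E) × E => g (Fin.snoc p.1 p.2) :=
    hg.comp measurable_snoc
  have hwg : Measurable fun z => wgt γ q m z * g z := hw.mul hg
  have hqw : Measurable fun p : (Fin m → E) × E => q m p.1 p.2 * wgt γ q m (Fin.snoc p.1 p.2) :=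
    hq.mul (hw.comp measurable_snoc)
  rw [omegaM]
  simp only [ratio_mul_div_marg hq hγ' hγt hqpos hqfin hqd hZ0 hZt hZ0' hβt hβ hδ0 hδ]
  simp only [ratio_eq hγ' hqpos hqfin hZ0 hZt]
  rw [lintegral_const_mul _ (measurable_lintegral_snoc hq hw), ← lintegral_propM hq μ hw,
    lintegral_smul_measure, lintegral_smul_measure, lintegral_map hg measurable_snoc,
    lintegral_withDensity_eq_lintegral_mul _ (hqw.const_mul _) hgs,
    lintegral_withDensity_eq_lintegral_mul _ hw hg,
    lintegral_prod _ ((hqw.const_mul _).mul hgs).aemeasurable]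
  have e : ∀ x, ∫⁻ y, ((fun p : (Fin m → E) × E =>
      Z m / Z (m + 1) * (q m p.1 p.2 * wgt γ q m (Fin.snoc p.1 p.2))) *
        fun p : (Fin m → E) × E => g (Fin.snoc p.1 p.2)) (x, y) ∂dx =
      Z m / Z (m + 1) * ∫⁻ y, q m x y * (wgt γ q m (Fin.snoc x y) * g (Fin.snoc x y)) ∂dx := by
    intro x
    rw [← lintegral_const_mul' _ _ hCt]
    refine lintegral_congr fun y => ?_
    simp only [Pi.mul_apply]
    ring
  simp only [e]
  rw [lintegral_const_mul _ (measurable_lintegral_snoc hq hwg), ← lintegral_propM hq μ hwg,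
    ENNReal.mul_inv (Or.inl hC0) (Or.inl hCt), smul_eq_mul, smul_eq_mul]
  calc _ = ((Z m / Z (m + 1))⁻¹ * (Z m / Z (m + 1))) *
        ((∫⁻ z, wgt γ q m z ∂(propM dx q m μ))⁻¹ *
          ∫⁻ z, wgt γ q m z * g z ∂(propM dx q m μ)) := by ring
    _ = _ := by rw [ENNReal.inv_mul_cancel hC0 hCt, one_mul]; rfl

lemma integral_smul_withDensity {S : Type*} [MeasurableSpace S] {ρ : Measure S}
    {w : S → ℝ≥0∞} (hw : Measurable w) (hwt : ∀ x, w x ≠ ⊤) {b : ℝ} (hb : b ≠ 0) (f : S → ℝ) :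
    ∫ z, f z ∂((∫⁻ z, w z ∂ρ)⁻¹ • ρ.withDensity w) =
      (∫ z, (w z).toReal / b * f z ∂ρ) / ∫ z, (w z).toReal / b ∂ρ := by
  have hwl : ∀ᵐ x ∂ρ, w x < ⊤ := ae_of_all _ fun x => (hwt x).lt_top
  have e : ∀ z, (w z).toReal / b * f z = (w z).toReal * f z / b := fun z => by ring
  rw [integral_smul_measure, integral_withDensity_eq_integral_toReal_smul hw hwl]
  simp only [e, integral_div, smul_eq_mul]
  rw [integral_toReal hw.aemeasurable hwl, ENNReal.toReal_inv, div_div_div_cancel_right₀ hb,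
    div_eq_inv_mul]

lemma le_integral_wgt (hq : Measurable fun p : (Fin m → E) × E => q m p.1 p.2)
    (hγ : Measurable (γ m)) (hγ' : Measurable (γ (m + 1)))
    (hqpos : ∀ x y, 0 < q m x y)
    (hqfin : ∀ x y, q m x y ≠ ⊤) (hqd : ∀ x, ∫⁻ y, q m x y ∂dx = 1)
    (hZ0 : Z m ≠ 0) (hZt : Z m ≠ ⊤) (hZ0' : Z (m + 1) ≠ 0) (hZt' : Z (m + 1) ≠ ⊤)
    {β : ℝ≥0∞} (hβt : β ≠ ⊤) (hβ : ∀ x, wgt γ q m x ≤ β)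
    {δ : ℝ≥0∞} (hδ : ∀ x, 0 < γ m x / Z m → δ ≤ ratio dx γ Z m x) {i : ℕ} {ω : Ω}
    (hX : ∀ k, 0 < γ m (X m k ω) / Z m) :
    ((Z m / Z (m + 1))⁻¹ * δ).toReal / (β.toReal + 1) ≤
      ∫ z, (wgt γ q m z).toReal / (β.toReal + 1) ∂(propM dx q m (emp X m i ω)) := by
  have hw := measurable_wgt hγ hγ' hq
  have hC0 : Z m / Z (m + 1) ≠ 0 := (ENNReal.div_pos hZ0 hZt').ne'
  have hCt : Z m / Z (m + 1) ≠ ⊤ := ENNReal.div_ne_top hZt hZ0'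
  have hwl : ∀ᵐ x ∂(propM dx q m (emp X m i ω)), wgt γ q m x < ⊤ :=
    ae_of_all _ fun x => (hβ x).trans_lt hβt.lt_top
  have := isProbabilityMeasure_propM (dx := dx) hq hqd (emp X m i ω)
  have hfin : ∫⁻ z, wgt γ q m z ∂(propM dx q m (emp X m i ω)) ≠ ⊤ := by
    refine ((lintegral_mono hβ).trans_lt ?_).ne
    simpa using hβt.lt_top
  rw [integral_div, integral_toReal hw.aemeasurable hwl]
  gcongr
  rw [lintegral_propM hq _ hw, lintegral_emp (measurable_lintegral_snoc hq hw)]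
  have hk : ∀ k ∈ Finset.range (i + 1), (Z m / Z (m + 1))⁻¹ * δ ≤
      ∫⁻ y, q m (X m k ω) y * wgt γ q m (Fin.snoc (X m k ω) y) ∂dx := fun k _ => by
    rw [ENNReal.inv_mul_le_iff hC0 hCt, ← ratio_eq hγ' hqpos hqfin hZ0 hZt]
    exact hδ _ (hX k)
  calc (Z m / Z (m + 1))⁻¹ * δ
      = ((i : ℝ≥0∞) + 1)⁻¹ * (((i : ℝ≥0∞) + 1) * ((Z m / Z (m + 1))⁻¹ * δ)) := by
        rw [← mul_assoc, ENNReal.inv_mul_cancel (by simp) (by finiteness), one_mul]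
    _ ≤ _ := by
        gcongr
        simpa using Finset.card_nsmul_le_sum _ _ _ hk

lemma ae_forall_mem_of_acc_eq_zero {S Ω : Type*} [MeasurableSpace S] {mΩ : MeasurableSpace Ω}
    {μ : Measure Ω} [IsProbabilityMeasure μ] {a : S → S → ℝ≥0∞}
    {F : ℕ → MeasurableSpace Ω} (hF : ∀ i, F i ≤ mΩ) {X : ℕ → Ω → S}
    (hX : ∀ i, Measurable (X i)) {ρ : ℕ → Ω → Measure S} {T : Set S} (hT : MeasurableSet T)
    (haT : ∀ x ∈ T, ∀ y ∉ T, a x y = 0) (h0 : ∀ ω, X 0 ω ∈ T)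
    (hlaw : ∀ i (g : S → ℝ), Measurable g → (∀ z, |g z| ≤ 1) →
      μ[(fun ω => g (X (i + 1) ω))|F (i + 1)] =ᵐ[μ]
        fun ω => ∫ z, g z ∂(mhKer a (ρ (i + 1) ω) (X i ω))) :
    ∀ᵐ ω ∂μ, ∀ i, X i ω ∈ T := by
  refine ae_all_iff.2 fun i => ?_
  induction i with
  | zero => exact ae_of_all _ h0
  | succ i ih =>
    have hg : Measurable (Tᶜ.indicator (1 : S → ℝ)) := measurable_one.indicator hT.compl
    have hg0 : ∀ z, 0 ≤ Tᶜ.indicator (1 : S → ℝ) z :=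
      Set.indicator_nonneg fun _ _ => zero_le_one
    have hg1 : ∀ z, |Tᶜ.indicator (1 : S → ℝ) z| ≤ 1 := fun z => by
      rw [abs_of_nonneg (hg0 z)]
      exact Set.indicator_le_self' (fun _ _ => zero_le_one) z
    have hker : ∀ᵐ ω ∂μ, ∫ z, Tᶜ.indicator (1 : S → ℝ) z
        ∂(mhKer a (ρ (i + 1) ω) (X i ω)) = 0 := by
      filter_upwards [ih] with ω hω
      rw [integral_indicator_one hT.compl, measureReal_def, mhKer, Measure.add_apply,
        withDensity_apply _ hT.compl, Measure.smul_apply, Measure.dirac_apply' _ hT.compl,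
        setLIntegral_eq_zero hT.compl fun y hy => haT _ hω y hy]
      simp [hω]
    have h_int : ∫ ω, Tᶜ.indicator (1 : S → ℝ) (X (i + 1) ω) ∂μ = 0 := by
      rw [← integral_condExp (hF (i + 1)), integral_congr_ae (hlaw i _ hg hg1),
        integral_congr_ae hker, integral_zero]
    rw [integral_eq_zero_iff_of_nonneg (fun _ => hg0 _)
      (integrable_of_bdd (hg.comp (hX (i + 1))) fun _ => hg1 _)] at h_int
    filter_upwards [h_int] with ω hω
    by_contra hn
    simp [hn] at hω

lemma ae_forall_density_pos {S Ω : Type*} [MeasurableSpace S] {mΩ : MeasurableSpace Ω}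
    {μ : Measure Ω} [IsProbabilityMeasure μ] {g d : S → ℝ≥0∞} {ζ : ℝ≥0∞} (hg : Measurable g)
    (hζ : ζ ≠ ⊤) {F : ℕ → MeasurableSpace Ω} (hF : ∀ i, F i ≤ mΩ) {X : ℕ → Ω → S}
    (hX : ∀ i, Measurable (X i)) {ρ : ℕ → Ω → Measure S} (h0 : ∀ ω, 0 < g (X 0 ω) / ζ)
    (hlaw : ∀ i (f : S → ℝ), Measurable f → (∀ z, |f z| ≤ 1) →
      μ[(fun ω => f (X (i + 1) ω))|F (i + 1)] =ᵐ[μ]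
        fun ω => ∫ z, f z ∂(mhKer (acc fun x => g x / d x) (ρ (i + 1) ω) (X i ω))) :
    ∀ᵐ ω ∂μ, ∀ i, 0 < g (X i ω) / ζ := by
  refine ae_forall_mem_of_acc_eq_zero hF hX (T := {x | 0 < g x / ζ})
    (measurableSet_lt measurable_const (hg.div_const ζ)) (fun x _ y hy => ?_) h0 hlaw
  have hgy : g y = 0 := by
    by_contra h
    exact hy (ENNReal.div_pos h hζ)
  simp [acc, hgy]

lemma past_le {mΩ : MeasurableSpace Ω} {P n : ℕ} (hn : n ≤ P)
    (hX : ∀ k i, 1 ≤ k → k ≤ P → Measurable (X k i)) (i : ℕ) : past P X n i ≤ mΩ := by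
  refine iSup_le fun k => iSup_le fun j => iSup_le fun h => (hX k j ?_ ?_).comap_le <;> omega

lemma past_mono {P n : ℕ} (hn : n ≤ P) : Monotone (past P X n) := by
  refine fun i i' hii => iSup_le fun k => iSup_le fun j => iSup_le fun h => ?_
  refine le_iSup_of_le k (le_iSup_of_le j (le_iSup_of_le ?_ le_rfl))
  omega

lemma measurable_past {P n i k j : ℕ}
    (h : (1 ≤ k ∧ k ≤ P ∧ j < i) ∨ (1 ≤ k ∧ k < n ∧ j = i)) :
    Measurable[past P X n i] (X k j) :=
  Measurable.of_comap_le (le_iSup_of_le k (le_iSup_of_le j (le_iSup_of_le h le_rfl)))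

end Interacting

theorem statement16
    (dx : Measure E) [SigmaFinite dx] (P : ℕ) (hP : 1 ≤ P)
    (γ : (n : ℕ) → (Fin n → E) → ℝ≥0∞)
    (hγ : ∀ n, 1 ≤ n → n ≤ P → Measurable (γ n))
    (hγfin : ∀ n, 1 ≤ n → n ≤ P → ∀ x, γ n x ≠ ⊤)
    (Z : ℕ → ℝ≥0∞)
    (hZ : ∀ n, 1 ≤ n → n ≤ P → Z n = ∫⁻ x, γ n x ∂(Measure.pi fun _ : Fin n => dx))
    (hZ0 : ∀ n, 1 ≤ n → n ≤ P → 0 < Z n) (hZt : ∀ n, 1 ≤ n → n ≤ P → Z n ≠ ⊤)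
    (q1 : E → ℝ≥0∞) (hq1 : Measurable q1) (hq1pos : ∀ y, 0 < q1 y)
    (hq1fin : ∀ y, q1 y ≠ ⊤) (hq1dens : ∫⁻ y, q1 y ∂dx = 1)
    (q : (m : ℕ) → (Fin m → E) → E → ℝ≥0∞)
    (hq : ∀ m, 1 ≤ m → m + 1 ≤ P → Measurable fun p : (Fin m → E) × E => q m p.1 p.2)
    (hqpos : ∀ m x y, 0 < q m x y) (hqfin : ∀ m x y, q m x y ≠ ⊤)
    (hqdens : ∀ m, 1 ≤ m → m + 1 ≤ P → ∀ x, ∫⁻ y, q m x y ∂dx = 1)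
    (B : ℕ → ℝ≥0∞) (hBt : ∀ n, 1 ≤ n → n ≤ P → B n ≠ ⊤)
    (hA11 : ∀ x : Fin 1 → E, 0 < γ 1 x / Z 1 → wgt1 γ q1 x ≤ B 1)
    (hA1 : ∀ m, 1 ≤ m → m + 1 ≤ P → ∀ x : Fin (m + 1) → E,
      0 < γ (m + 1) x / Z (m + 1) → wgt γ q m x ≤ B (m + 1))
    (hδ : ∀ m, 1 ≤ m → m + 1 ≤ P → ∃ δ : ℝ≥0∞, 0 < δ ∧
      ∀ x : Fin m → E, 0 < γ m x / Z m → δ ≤ ratio dx γ Z m x)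
    :
    ∃ C1 : ℕ → ℝ, ∃ C2 : ℝ → ℝ,
      ∀ m, 1 ≤ m → m + 1 ≤ P → ∀ p : ℝ, 1 ≤ p →
      ∀ (Ω : Type*) [MeasurableSpace Ω] (μ : Measure Ω) [IsProbabilityMeasure μ]
        (X : (n : ℕ) → ℕ → Ω → (Fin n → E)) (x0 : (n : ℕ) → Fin n → E),
        (∀ k i, 1 ≤ k → k ≤ P → Measurable (X k i)) →
        (∀ k, 1 ≤ k → k ≤ P → 0 < γ k (x0 k) / Z k) →
        (∀ k, 1 ≤ k → k ≤ P → ∀ ω, X k 0 ω = x0 k) →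
        (∀ i, 1 ≤ i → ∀ g : (Fin 1 → E) → ℝ, Measurable g → (∀ z, |g z| ≤ 1) →
          (μ[(fun ω => g (X 1 i ω))|past P X 1 i]) =ᵐ[μ]
            fun ω => ∫ z, g z ∂(ker1 dx γ q1 (X 1 (i - 1) ω))) →
        (∀ m, 1 ≤ m → m + 1 ≤ P → ∀ i, 1 ≤ i → ∀ g : (Fin (m + 1) → E) → ℝ,
          Measurable g → (∀ z, |g z| ≤ 1) →
          (μ[(fun ω => g (X (m + 1) i ω))|past P X (m + 1) i]) =ᵐ[μ]
            fun ω => ∫ z, g z ∂(kerM dx γ q m (emp X m i ω) (X (m + 1) (i - 1) ω))) →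
        ∀ f : (Fin (m + 1) → E) → ℝ, Measurable f → (∀ z, |f z| ≤ 1) → ∀ i : ℕ,
          (∫ ω, |((i : ℝ) + 1)⁻¹ * (∑ k ∈ Finset.range (i + 1), f (X (m + 1) k ω)) -
              ((i : ℝ) + 1)⁻¹ * (∑ k ∈ Finset.range (i + 1),
                ∫ z, f z ∂(omegaM dx γ Z m (emp X m k ω)))| ^ p ∂μ) ^ (1 / p) ≤
            C1 (m + 1) * C2 p / ((i : ℝ) + 1) ^ ((1 : ℝ) / 2) := by
  choose! δ hδ0 hδr using hδ
  let ε : ℕ → ℝ := fun n =>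
    ((Z (n - 1) / Z n)⁻¹ * min (δ (n - 1)) 1).toReal / ((B n).toReal + 1)
  refine ⟨fun n => 2 / ε n *
    (2 * Real.exp ((4 + 2 / ε n + 8 / (ε n) ^ 2) / (2 / ε n) + 1)),
    fun p => (1 + (⌈p⌉₊.factorial : ℝ)) ^ (1 / p), ?_⟩
  intro m hm1 hmP p hp Ω _ μ _ X x0 hX hx0 hX0 h_one h_succ f hf hf1 i
  have hmP' : m ≤ P := by omega
  have hγm := hγ m hm1 hmP'
  have hγm' := hγ (m + 1) (by omega) hmP
  have hZm0 := (hZ0 m hm1 hmP').ne'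
  have hZmt := hZt m hm1 hmP'
  have hZm0' := (hZ0 (m + 1) (by omega) hmP).ne'
  have hZmt' := hZt (m + 1) (by omega) hmP
  have hBm := hBt (m + 1) (by omega) hmP
  have hqm := hq m hm1 hmP
  have hqd := hqdens m hm1 hmP
  have hw : Measurable (wgt γ q m) := measurable_wgt hγm hγm' hqm
  have hwB : ∀ x, wgt γ q m x ≤ B (m + 1) := wgt_le hZmt' (hA1 m hm1 hmP)
  have hwt : ∀ x, wgt γ q m x ≠ ⊤ := fun x => ((hwB x).trans_lt hBm.lt_top).ne
  have hb : (0 : ℝ) < (B (m + 1)).toReal + 1 := by positivity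
  have hδ' : ∀ x : Fin m → E, 0 < γ m x / Z m → min (δ m) 1 ≤ ratio dx γ Z m x :=
    fun x hx => (min_le_left _ _).trans (hδr m hm1 hmP x hx)
  have hε : 0 < ε (m + 1) := by
    refine div_pos (ENNReal.toReal_pos (mul_ne_zero ?_ ?_) (ENNReal.mul_ne_top ?_ ?_)) hb
    · exact ENNReal.inv_ne_zero.2 (ENNReal.div_ne_top hZmt hZm0')
    · exact (lt_min (hδ0 m hm1 hmP) one_pos).ne'
    · exact ENNReal.inv_ne_top.2 (ENNReal.div_pos hZm0 hZmt').ne'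
    · exact (min_le_right _ _).trans_lt ENNReal.one_lt_top |>.ne
  have hsupp : ∀ᵐ ω ∂μ, ∀ k, 0 < γ m (X m k ω) / Z m := by
    have hstart : ∀ ω, 0 < γ m (X m 0 ω) / Z m := fun ω => by
      rw [hX0 m hm1 hmP']
      exact hx0 m hm1 hmP'
    obtain _ | _ | l := m
    · omega
    · exact ae_forall_density_pos (ρ := fun _ _ => prop1 dx q1) hγm hZmt
        (past_le hmP' hX) (fun k => hX _ k hm1 hmP') hstart
        fun k g hg hg1 => h_one (k + 1) k.succ_pos g hg hg1
    · exact ae_forall_density_pos (ρ := fun k ω => propM dx q (l + 1) (emp X (l + 1) k ω))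
        hγm hZmt (past_le hmP' hX) (fun k => hX _ k hm1 hmP') hstart
        fun k g hg hg1 => h_succ (l + 1) l.succ_pos hmP' (k + 1) k.succ_pos g hg hg1
  have hprob : ∀ k ω, IsProbabilityMeasure (propM dx q m (emp X m k ω)) :=
    fun k ω => isProbabilityMeasure_propM hqm hqd _
  have hmain := (isAcceptance_acc hw hBm hwB).moment_ergodic_average_le hf hf1 hε
    (past_le hmP hX) (past_mono hmP) (X := X (m + 1))
    (fun k => measurable_past (Or.inl ⟨by omega, hmP, by omega⟩))
    (ρ := fun k ω => propM dx q m (emp X m k ω))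
    (fun k => @measurable_propM_emp _ _ _ _ _ _ _ _ (past P X (m + 1) k) hqm _ fun j hj =>
      measurable_past (by omega))
    (fun k g hg hg1 => h_succ m hm1 hmP (k + 1) k.succ_pos g hg hg1)
    (hsupp.mono fun ω hω k => le_integral_wgt hqm hγm hγm' (hqpos m) (hqfin m) hqd hZm0 hZmt
      hZm0' hZmt' hBm hwB hδ' hω)
    (fun k ω g hg hg1 => abs_integral_propM_emp_sub_le hqm hqd hg hg1 k ω) hp i
  simpa only [omegaM_eq hqm hγm hγm' (hγfin m hm1 hmP') (hqpos m) (hqfin m) hqd hZm0 hZmt hZm0'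
    hZmt' hBm hwB (hδ0 m hm1 hmP) (hδr m hm1 hmP), integral_smul_withDensity hw hwt hb.ne']
    using hmain

end

end Paper
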